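/- Let P be a finite set of points in ℝ² in general position, let k ≥ 1, and let {u,v} be a useful order-k Delaunay edge of P that is not a useful order-i Delaunay edge for any i < k. Let H be the hull of {u,v}, i.e., the closure of the union of all triangles of the Delaunay triangulation of P whose interior intersects the segment uv. Then there exists a finite set S of triangles with vertices among the points of P lying in H, with pairwise disjoint interiors, whose union equals H, such that segment uv is a side of some triangle of S, every triangle of S is an order-k Delaunay triangle with respect to P, and at least one triangle of S is not order-(k−1) Delaunay with respect to P. -/

import Mathlib

open EuclideanGeometry Set

noncomputable section

/-- Points of the Euclidean plane. -/
abbrev Pt : Type := EuclideanSpace ℝ (Fin 2)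

noncomputable instance : DecidableEq Pt := Classical.decEq _

/-- `P` is in general position: no three (distinct) points collinear and
no four (distinct) points concyclic. -/
def GenPos (P : Set Pt) : Prop :=
  (∀ u v w : Pt, u ∈ P → v ∈ P → w ∈ P → u ≠ v → u ≠ w → v ≠ w →
    ¬ Collinear ℝ ({u, v, w} : Set Pt)) ∧
  (∀ u v w z : Pt, u ∈ P → v ∈ P → w ∈ P → z ∈ P →
    u ≠ v → u ≠ w → u ≠ z → v ≠ w → v ≠ z → w ≠ z →
    ¬ EuclideanGeometry.Cospherical ({u, v, w, z} : Set Pt))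

/-- The (closed) triangle spanned by a finite set of points. -/
def triSet (t : Finset Pt) : Set Pt := convexHull ℝ (t : Set Pt)

/-- `T` is a triangulation of `P`: a finite set of triangles with vertices in `P`,
every point of `P` is a vertex of some triangle, the interiors of the triangles are
pairwise disjoint, and their union is the convex hull of `P`. -/
def IsTriangulation (P : Set Pt) (T : Set (Finset Pt)) : Prop :=
  T.Finite ∧
  (∀ t ∈ T, t.card = 3 ∧ (t : Set Pt) ⊆ P) ∧
  (∀ p ∈ P, ∃ t ∈ T, p ∈ t) ∧
  (T.Pairwise fun t s => interior (triSet t) ∩ interior (triSet s) = ∅) ∧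
  (⋃ t ∈ T, triSet t) = convexHull ℝ P

/-- The triangle `t` (with vertex set `t`) is order-`k` Delaunay with respect to `P`:
the open disk bounded by its circumcircle contains at most `k` points of `P`. -/
def OrderKTri (P : Set Pt) (k : ℕ) (t : Finset Pt) : Prop :=
  ∃ z : Pt, ∃ r : ℝ, (∀ p ∈ t, dist p z = r) ∧ {p ∈ P | dist p z < r}.encard ≤ (k : ℕ∞)

/-- `T` is an order-`k` Delaunay triangulation of `P`. -/
def IsOrderDT (P : Set Pt) (k : ℕ) (T : Set (Finset Pt)) : Prop :=
  IsTriangulation P T ∧ ∀ t ∈ T, OrderKTri P k t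

/-- `{u, v}` is an order-`k` Delaunay edge of `P`: some open disk having `u` and `v`
on its boundary circle contains at most `k` points of `P`. -/
def OrderKEdge (P : Set Pt) (k : ℕ) (u v : Pt) : Prop :=
  ∃ z : Pt, ∃ r : ℝ, dist u z = r ∧ dist v z = r ∧ {p ∈ P | dist p z < r}.encard ≤ (k : ℕ∞)

/-- `{u, v}` is a useful order-`k` Delaunay edge of `P`: some order-`k` Delaunay
triangulation of `P` contains a triangle having `u` and `v` among its vertices
(i.e. having segment `uv` as a side). -/
def UsefulEdge (P : Set Pt) (k : ℕ) (u v : Pt) : Prop :=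
  ∃ T, IsOrderDT P k T ∧ ∃ t ∈ T, u ∈ t ∧ v ∈ t

/-- `{u, v}` is a Delaunay edge: it is an edge of the (unique) order-0 Delaunay
triangulation of `P`. -/
def DelaunayEdge (P : Set Pt) (u v : Pt) : Prop := UsefulEdge P 0 u v

/-- `p` lies strictly to the left of the directed line from `v` to `u`, i.e. the
triple `v, u, p` makes a counterclockwise turn. -/
def ccw (v u p : Pt) : Prop :=
  0 < (u 0 - v 0) * (p 1 - v 1) - (u 1 - v 1) * (p 0 - v 0)


/-! ### Affine functions and powers of points -/

/-- The real function `L` on the plane is affine. -/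
def IsAff (L : Pt → ℝ) : Prop :=
  ∀ x y : Pt, ∀ a : ℝ, L (AffineMap.lineMap x y a) = (1 - a) * L x + a * L y

/-- The power of `x` with respect to the circle with centre `z` and squared radius `c`. -/
def pw (z : Pt) (c : ℝ) (x : Pt) : ℝ := (x 0 - z 0) ^ 2 + (x 1 - z 1) ^ 2 - c

/-- Twice the signed area of the triangle `a b x`. -/
def orient (a b x : Pt) : ℝ := (b 0 - a 0) * (x 1 - a 1) - (b 1 - a 1) * (x 0 - a 0)

lemma lineMap_coord (x y : Pt) (a : ℝ) (i : Fin 2) :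
    (AffineMap.lineMap x y a : Pt) i = (1 - a) * x i + a * y i := by
  simp [AffineMap.lineMap_apply]; ring

lemma pt_ext {x y : Pt} (h0 : x 0 = y 0) (h1 : x 1 = y 1) : x = y := by
  ext i; fin_cases i <;> assumption

lemma dist_sq_eq_pw (x z : Pt) (c : ℝ) : dist x z ^ 2 = pw z c x + c := by
  rw [EuclideanSpace.dist_eq, Real.sq_sqrt (by positivity)]
  simp [pw, Fin.sum_univ_two, Real.dist_eq, sq_abs]

lemma dist_lt_iff_pw {x z : Pt} {r : ℝ} (hr : 0 ≤ r) : dist x z < r ↔ pw z (r ^ 2) x < 0 := by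
  rw [← sq_lt_sq₀ dist_nonneg hr, dist_sq_eq_pw x z (r ^ 2)]
  constructor <;> intro h <;> linarith

lemma dist_eq_iff_pw {x z : Pt} {r : ℝ} (hr : 0 ≤ r) : dist x z = r ↔ pw z (r ^ 2) x = 0 := by
  rw [← sq_eq_sq₀ dist_nonneg hr, dist_sq_eq_pw x z (r ^ 2)]
  constructor <;> intro h <;> linarith

lemma isAff_orient (a b : Pt) : IsAff (orient a b) := by
  intro x y s; simp only [orient, lineMap_coord]; ring

lemma isAff_pw_sub (z z' : Pt) (c c' : ℝ) : IsAff fun x => pw z c x - pw z' c' x := by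
  intro x y s; simp only [pw, lineMap_coord]; ring

lemma IsAff.neg {L : Pt → ℝ} (hL : IsAff L) : IsAff fun x => -L x := by
  intro x y s; simp only [hL x y s]; ring

lemma pw_lineMap (z : Pt) (c : ℝ) (x y : Pt) (a : ℝ) :
    pw z c (AffineMap.lineMap x y a) = (1 - a) * pw z c x + a * pw z c y
      - a * (1 - a) * ((x 0 - y 0) ^ 2 + (x 1 - y 1) ^ 2) := by
  simp only [pw, lineMap_coord]; ring

lemma pw_lineMap_le (z : Pt) (c : ℝ) (x y : Pt) {a : ℝ} (h0 : 0 ≤ a) (h1 : a ≤ 1) :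
    pw z c (AffineMap.lineMap x y a) ≤ (1 - a) * pw z c x + a * pw z c y := by
  rw [pw_lineMap]
  have : 0 ≤ a * (1 - a) * ((x 0 - y 0) ^ 2 + (x 1 - y 1) ^ 2) := by
    have := sub_nonneg.2 h1; positivity
  linarith

lemma pw_lineMap_neg_of_right {z : Pt} {c : ℝ} {x y : Pt} {a : ℝ} (h0 : 0 < a) (h1 : a ≤ 1)
    (hx : pw z c x ≤ 0) (hy : pw z c y < 0) : pw z c (AffineMap.lineMap x y a) < 0 := by
  have := pw_lineMap_le z c x y h0.le h1
  nlinarith [mul_pos_of_neg_of_neg hy (neg_lt_zero.2 h0),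
    mul_nonneg (sub_nonneg.2 h1) (neg_nonneg.2 hx)]

lemma IsAff.convex_nonneg {L : Pt → ℝ} (hL : IsAff L) : Convex ℝ {x | 0 ≤ L x} := by
  intro x hx y hy a b ha hb hab
  have := hL x y b
  rw [AffineMap.lineMap_apply_module, show 1 - b = a by linarith] at this
  simp only [mem_ofPred_eq] at *
  rw [this]; positivity

lemma IsAff.nonneg_of_mem_triSet {L : Pt → ℝ} (hL : IsAff L) {t : Finset Pt}
    (ht : ∀ p ∈ t, 0 ≤ L p) {x : Pt} (hx : x ∈ triSet t) : 0 ≤ L x :=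
  convexHull_min (s := (t : Set Pt)) (fun p hp => ht p hp) hL.convex_nonneg hx

lemma exists_lineMap_mem_nhds {U : Set Pt} {x : Pt} (hU : U ∈ nhds x) (y : Pt) :
    ∃ e : ℝ, 0 < e ∧ e < 1 ∧ AffineMap.lineMap x y e ∈ U ∧ AffineMap.lineMap x y (-e) ∈ U := by
  have hc : Continuous fun e : ℝ => (AffineMap.lineMap x y e : Pt) := AffineMap.lineMap_continuous
  have h1 : ∀ᶠ e in nhds (0 : ℝ), (AffineMap.lineMap x y e : Pt) ∈ U :=
    hc.continuousAt.eventually_mem (by simpa using hU)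
  obtain ⟨d, hd, hd'⟩ := Metric.eventually_nhds_iff.1 h1
  refine ⟨min (d / 2) (1 / 2), by positivity, by
    exact (min_le_right _ _).trans_lt (by norm_num), hd' ?_, hd' ?_⟩ <;>
  · rw [Real.dist_eq, sub_zero]
    try rw [abs_neg]
    rw [abs_of_pos (by positivity)]
    exact (min_le_left _ _).trans_lt (by linarith)

/-- An affine function which is nonnegative on a set and nonpositive at an interior point of it
vanishes identically. -/
lemma IsAff.eq_zero_of_interior {L : Pt → ℝ} (hL : IsAff L) {A : Set Pt} (hA : ∀ p ∈ A, 0 ≤ L p)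
    {x : Pt} (hx : x ∈ interior A) (hLx : L x ≤ 0) (y : Pt) : L y = 0 := by
  obtain ⟨e, he, -, h1, h2⟩ := exists_lineMap_mem_nhds (mem_interior_iff_mem_nhds.1 hx) y
  have h1 := hA _ h1
  have h2 := hA _ h2
  have h0 : L x = 0 := le_antisymm hLx (hA x (interior_subset hx))
  rw [hL, h0] at h1 h2
  nlinarith

lemma triSet_pw_nonpos {t : Finset Pt} {z : Pt} {c : ℝ} (ht : ∀ p ∈ t, pw z c p = 0) {x : Pt}
    (hx : x ∈ triSet t) : pw z c x ≤ 0 := by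
  have hconv : Convex ℝ {x | pw z c x ≤ 0} := by
    intro x hx y hy a b ha hb hab
    have := pw_lineMap_le z c x y hb (by linarith)
    rw [AffineMap.lineMap_apply_module, show 1 - b = a by linarith] at this
    simp only [mem_ofPred_eq] at *
    nlinarith
  exact convexHull_min (s := (t : Set Pt)) (fun p hp => (ht p hp).le) hconv hx

lemma interior_triSet_pw_neg {t : Finset Pt} {z : Pt} {c : ℝ} (ht : ∀ p ∈ t, pw z c p = 0) {x : Pt}
    (hx : x ∈ interior (triSet t)) : pw z c x < 0 := by
  obtain ⟨y, hy⟩ := exists_ne x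
  obtain ⟨e, he, -, h1, h2⟩ := exists_lineMap_mem_nhds (mem_interior_iff_mem_nhds.1 hx) y
  have h1 := triSet_pw_nonpos ht h1
  have h2 := triSet_pw_nonpos ht h2
  rw [pw_lineMap] at h1 h2
  have : 0 < (x 0 - y 0) ^ 2 + (x 1 - y 1) ^ 2 := by
    by_contra hcon
    exact hy (pt_ext (by nlinarith [sq_nonneg (x 0 - y 0), sq_nonneg (x 1 - y 1)])
      (by nlinarith [sq_nonneg (x 0 - y 0), sq_nonneg (x 1 - y 1)]))
  nlinarith [mul_pos (mul_pos he he) this]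

/-! ### Triangles -/

lemma mem_triSet_iff {a b c x : Pt} : x ∈ triSet {a, b, c} ↔ ∃ l m n : ℝ, 0 ≤ l ∧ 0 ≤ m ∧ 0 ≤ n ∧
    l + m + n = 1 ∧ ∀ i, x i = l * a i + m * b i + n * c i := by
  simp only [triSet, Finset.coe_insert, Finset.coe_singleton]
  rw [convexHull_insert (by simp), convexHull_pair, mem_convexJoin]
  constructor
  · rintro ⟨p, hp, q, ⟨r, s, hr, hs, hrs, rfl⟩, ⟨r', s', hr', hs', hrs', rfl⟩⟩
    rw [mem_singleton_iff] at hp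
    subst hp
    refine ⟨r', s' * r, s' * s, hr', by positivity, by positivity, ?_, fun i => ?_⟩
    · rw [add_assoc, ← mul_add, hrs, mul_one, hrs']
    · simp; ring
  · rintro ⟨l, m, n, hl, hm, hn, hs, hx⟩
    by_cases hmn : m + n = 0
    · have hm0 : m = 0 := by linarith
      have hn0 : n = 0 := by linarith
      have hl1 : l = 1 := by linarith
      have : x = a := pt_ext (by rw [hx, hm0, hn0, hl1]; ring) (by rw [hx, hm0, hn0, hl1]; ring)
      exact ⟨a, rfl, b, left_mem_segment _ _ _, this ▸ left_mem_segment _ _ _⟩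
    · have hpos : 0 < m + n := lt_of_le_of_ne (by positivity) (Ne.symm hmn)
      refine ⟨a, rfl, (m / (m + n)) • b + (n / (m + n)) • c, ⟨_, _, by positivity, by positivity,
        by field_simp, rfl⟩, ⟨l, m + n, hl, hpos.le, by linarith, ?_⟩⟩
      apply pt_ext <;> (simp [hx]; field_simp; ring)

lemma orient_barycentric {a b c : Pt} (h : orient a b c ≠ 0) (x : Pt) :
    orient b c x / orient a b c + orient c a x / orient a b c + orient a b x / orient a b c = 1 ∧
    ∀ i, x i = orient b c x / orient a b c * a i + orient c a x / orient a b c * b i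
      + orient a b x / orient a b c * c i := by
  constructor
  · rw [← add_div, ← add_div, div_eq_one_iff_eq h]; simp only [orient]; ring
  · intro i
    have : x i * orient a b c = orient b c x * a i + orient c a x * b i + orient a b x * c i := by
      fin_cases i <;> simp [orient] <;> ring
    field_simp
    linarith

lemma continuous_orient (a b : Pt) : Continuous (orient a b) := by
  unfold orient; fun_prop

lemma orient_of_barycentric {a b c x : Pt} {l m n : ℝ} (hs : l + m + n = 1)
    (hx : ∀ i, x i = l * a i + m * b i + n * c i) :
    orient b c x = l * orient a b c ∧ orient c a x = m * orient a b c ∧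
      orient a b x = n * orient a b c := by
  obtain rfl : l = 1 - m - n := by linarith
  simp only [orient, hx]
  refine ⟨?_, ?_, ?_⟩ <;> ring

lemma mem_interior_triSet {a b c x : Pt} {l m n : ℝ} (h : orient a b c ≠ 0) (hl : 0 < l)
    (hm : 0 < m) (hn : 0 < n) (hs : l + m + n = 1) (hx : ∀ i, x i = l * a i + m * b i + n * c i) :
    x ∈ interior (triSet {a, b, c}) := by
  rw [mem_interior]
  refine ⟨{y | 0 < orient b c y / orient a b c} ∩ {y | 0 < orient c a y / orient a b c} ∩
    {y | 0 < orient a b y / orient a b c}, ?_, ?_, ?_⟩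
  · rintro y ⟨⟨h1, h2⟩, h3⟩
    obtain ⟨hs, hy⟩ := orient_barycentric h y
    exact mem_triSet_iff.2 ⟨_, _, _, le_of_lt h1, le_of_lt h2, le_of_lt h3, hs, hy⟩
  · refine ((isOpen_lt ?_ ?_).inter (isOpen_lt ?_ ?_)).inter (isOpen_lt ?_ ?_)
    all_goals first
      | exact continuous_const
      | exact (continuous_orient _ _).div_const _
  · obtain ⟨h1, h2, h3⟩ := orient_of_barycentric hs hx
    simp only [mem_inter_iff, mem_ofPred_eq, h1, h2, h3, mul_div_cancel_right₀ _ h]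
    exact ⟨⟨hl, hm⟩, hn⟩

lemma collinear_of_orient_eq_zero {a b x : Pt} (hab : a ≠ b) (h : orient a b x = 0) :
    ∃ s : ℝ, x = AffineMap.lineMap a b s := by
  have hpos : 0 < (b 0 - a 0) ^ 2 + (b 1 - a 1) ^ 2 := by
    by_contra hcon
    exact hab (pt_ext (by nlinarith [sq_nonneg (b 0 - a 0), sq_nonneg (b 1 - a 1)])
      (by nlinarith [sq_nonneg (b 0 - a 0), sq_nonneg (b 1 - a 1)]))
  simp only [orient] at h
  refine ⟨((b 0 - a 0) * (x 0 - a 0) + (b 1 - a 1) * (x 1 - a 1)) /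
    ((b 0 - a 0) ^ 2 + (b 1 - a 1) ^ 2), pt_ext ?_ ?_⟩ <;>
  · rw [lineMap_coord]
    field_simp
    first
      | linear_combination (b 1 - a 1) * (-h)
      | linear_combination (b 0 - a 0) * h

lemma GenPos.orient_ne_zero {P : Set Pt} (hgp : GenPos P) {a b c : Pt} (ha : a ∈ P) (hb : b ∈ P)
    (hc : c ∈ P) (hab : a ≠ b) (hac : a ≠ c) (hbc : b ≠ c) : orient a b c ≠ 0 := by
  intro h
  obtain ⟨s, rfl⟩ := collinear_of_orient_eq_zero hab h
  refine hgp.1 a b _ ha hb hc hab hac hbc ?_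
  rw [collinear_iff_of_mem (p₀ := a) (by simp)]
  refine ⟨b - a, ?_⟩
  rintro p (rfl | rfl | rfl)
  · exact ⟨0, by simp⟩
  · exact ⟨1, by simp⟩
  · exact ⟨s, by simp [AffineMap.lineMap_apply]⟩

/-- The point `x` lies on no line through two points of `P`. -/
def IsGeneric (P : Set Pt) (x : Pt) : Prop := ∀ a ∈ P, ∀ b ∈ P, a ≠ b → orient a b x ≠ 0

lemma dense_orient_ne_zero {a b : Pt} (hab : a ≠ b) : Dense {x | orient a b x ≠ 0} := by
  obtain ⟨w, hw⟩ : ∃ w, orient a b w ≠ 0 := by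
    by_contra! hcon
    have h1 := hcon (!₂[a 0, a 1 + 1])
    have h2 := hcon (!₂[a 0 + 1, a 1])
    simp [orient] at h1 h2
    exact hab (pt_ext (by linarith) (by linarith))
  intro y
  rw [mem_closure_iff_nhds]
  intro U hU
  by_cases hy : orient a b y = 0
  · obtain ⟨e, he, -, h1, -⟩ := exists_lineMap_mem_nhds hU w
    refine ⟨_, h1, ?_⟩
    rw [mem_ofPred_eq, isAff_orient, hy, mul_zero, zero_add]
    exact mul_ne_zero he.ne' hw
  · exact ⟨y, mem_of_mem_nhds hU, hy⟩

lemma dense_isGeneric {P : Set Pt} (hP : P.Finite) : Dense {x | IsGeneric P x} := by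
  have h : {x | IsGeneric P x} = ⋂ p ∈ {p ∈ P ×ˢ P | p.1 ≠ p.2}, {x | orient p.1 p.2 x ≠ 0} := by
    ext x
    simp only [IsGeneric, mem_ofPred_eq, mem_iInter, mem_prod, Prod.forall]
    exact ⟨fun h a b hab => h a hab.1.1 b hab.1.2 hab.2, fun h a ha b hb hab => h a b ⟨⟨ha, hb⟩, hab⟩⟩
  rw [h]
  refine dense_biInter_of_isOpen ?_ ((hP.prod hP).subset (sep_subset _ _)).countable ?_
  · rintro ⟨a, b⟩ -
    exact isOpen_ne_fun (continuous_orient a b) continuous_const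
  · rintro ⟨a, b⟩ ⟨-, hab⟩
    exact dense_orient_ne_zero hab

lemma exists_isGeneric_mem {P : Set Pt} (hP : P.Finite) {U : Set Pt} (hU : IsOpen U)
    (hne : U.Nonempty) : ∃ x ∈ U, IsGeneric P x :=
  (dense_isGeneric hP).exists_mem_open hU hne |>.imp fun _ h => ⟨h.2, h.1⟩

lemma orient_swap (a b c : Pt) : orient b a c = -orient a b c := by simp only [orient]; ring

/-- A point of a triangle which is on no line through two of the vertices is an interior point. -/
lemma mem_interior_of_orient_ne_zero {t : Finset Pt} (hcard : t.card = 3) {x : Pt}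
    (hx : x ∈ triSet t) (hgen : ∀ a ∈ t, ∀ b ∈ t, a ≠ b → orient a b x ≠ 0) :
    x ∈ interior (triSet t) := by
  obtain ⟨a, b, c, hab, hac, hbc, rfl⟩ := Finset.card_eq_three.1 hcard
  obtain ⟨l, m, n, hl, hm, hn, hs, h⟩ := mem_triSet_iff.1 hx
  obtain ⟨h1, h2, h3⟩ := orient_of_barycentric hs h
  have g1 := hgen b (by simp) c (by simp) hbc
  have g2 := hgen c (by simp) a (by simp) hac.symm
  have g3 := hgen a (by simp) b (by simp) hab
  rw [h1] at g1
  rw [h2] at g2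
  rw [h3] at g3
  exact mem_interior_triSet (right_ne_zero_of_mul g1)
    (hl.lt_of_ne' (left_ne_zero_of_mul g1)) (hm.lt_of_ne' (left_ne_zero_of_mul g2))
    (hn.lt_of_ne' (left_ne_zero_of_mul g3)) hs h

lemma IsGeneric.mem_interior {P : Set Pt} {x : Pt} (hx : IsGeneric P x) {t : Finset Pt}
    (hcard : t.card = 3) (htP : (t : Set Pt) ⊆ P) (hxt : x ∈ triSet t) :
    x ∈ interior (triSet t) :=
  mem_interior_of_orient_ne_zero hcard hxt fun a ha b hb => hx a (htP ha) b (htP hb)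

lemma GenPos.interior_nonempty {P : Set Pt} (hgp : GenPos P) {t : Finset Pt}
    (hcard : t.card = 3) (htP : (t : Set Pt) ⊆ P) : (interior (triSet t)).Nonempty := by
  obtain ⟨a, b, c, hab, hac, hbc, rfl⟩ := Finset.card_eq_three.1 hcard
  have h := hgp.orient_ne_zero (htP (show a ∈ _ by simp)) (htP (show b ∈ _ by simp))
    (htP (show c ∈ _ by simp)) hab hac hbc
  refine ⟨(1 / 3 : ℝ) • a + (1 / 3 : ℝ) • b + (1 / 3 : ℝ) • c,
    mem_interior_triSet h (l := 1 / 3) (m := 1 / 3) (n := 1 / 3) (by norm_num) (by norm_num)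
      (by norm_num) (by norm_num) fun i => by simp⟩

lemma isClosed_triSet (t : Finset Pt) : IsClosed (triSet t) :=
  (t.finite_toSet.isCompact_convexHull ℝ).isClosed

lemma GenPos.triSet_subset_closure {P : Set Pt} (hgp : GenPos P) {t : Finset Pt}
    (hcard : t.card = 3) (htP : (t : Set Pt) ⊆ P) : triSet t ⊆ closure (interior (triSet t)) := by
  have hc : Convex ℝ (triSet t) := convex_convexHull ℝ _
  rw [hc.closure_interior_eq_closure_of_nonempty_interior (hgp.interior_nonempty hcard htP)]
  exact subset_closure

/-- A closed set containing all generic interior points of a triangle contains the triangle. -/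
lemma GenPos.triSet_subset_of_isGeneric {P : Set Pt} (hgp : GenPos P) (hP : P.Finite)
    {t : Finset Pt} (hcard : t.card = 3) (htP : (t : Set Pt) ⊆ P) {A : Set Pt} (hA : IsClosed A)
    (h : ∀ x ∈ interior (triSet t), IsGeneric P x → x ∈ A) : triSet t ⊆ A := by
  have h1 : interior (triSet t) ⊆ closure (interior (triSet t) ∩ {x | IsGeneric P x}) :=
    (dense_isGeneric hP).open_subset_closure_inter isOpen_interior
  refine (hgp.triSet_subset_closure hcard htP).trans
    (closure_minimal (h1.trans (closure_minimal ?_ hA)) hA)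
  exact fun x hx => h x hx.1 hx.2

/-- Two triangles of a triangulation with a common interior point coincide. -/
lemma IsTriangulation.eq_of_interior {P : Set Pt} {T : Set (Finset Pt)} (hT : IsTriangulation P T)
    {s t : Finset Pt} (hs : s ∈ T) (ht : t ∈ T) {x : Pt} (hxs : x ∈ interior (triSet s))
    (hxt : x ∈ interior (triSet t)) : s = t := by
  by_contra hne
  have := hT.2.2.2.1 hs ht hne
  exact (this ▸ (⟨hxs, hxt⟩ : x ∈ interior (triSet s) ∩ interior (triSet t)) : x ∈ (∅ : Set Pt))

lemma IsTriangulation.eq_of_interior_of_mem {P : Set Pt} {T : Set (Finset Pt)} (hgp : GenPos P)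
    (hT : IsTriangulation P T) {s t : Finset Pt} (hs : s ∈ T) (ht : t ∈ T) {x : Pt}
    (hxs : x ∈ interior (triSet s)) (hxt : x ∈ triSet t) : s = t := by
  have := hgp.triSet_subset_closure (hT.2.1 t ht).1 (hT.2.1 t ht).2 hxt
  obtain ⟨y, hy⟩ := mem_closure_iff.1 this _ isOpen_interior hxs
  exact hT.eq_of_interior hs ht hy.1 hy.2

/-- In a triangulation, the only points of `P` in a triangle are its vertices. -/
lemma IsTriangulation.mem_of_mem_triSet {P : Set Pt} {T : Set (Finset Pt)} (hgp : GenPos P)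
    (hT : IsTriangulation P T) {t : Finset Pt} (ht : t ∈ T) {p : Pt} (hp : p ∈ P)
    (hpt : p ∈ triSet t) : p ∈ t := by
  by_contra hcon
  obtain ⟨s, hs, hps⟩ := hT.2.2.1 p hp
  have hint : p ∈ interior (triSet t) := by
    refine mem_interior_of_orient_ne_zero (hT.2.1 t ht).1 hpt fun a ha b hb hab => ?_
    exact hgp.orient_ne_zero ((hT.2.1 t ht).2 ha) ((hT.2.1 t ht).2 hb) hp hab
      (fun h => hcon (h ▸ ha)) (fun h => hcon (h ▸ hb))
  have := hT.eq_of_interior_of_mem hgp ht hs hint (subset_convexHull ℝ _ hps)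
  exact hcon (this ▸ hps)

/-! ### Delaunay triangles -/

/-- The triangle `t` is a Delaunay triangle of `Q`, with circumcentre `z` and squared
circumradius `c`. -/
structure IsDelaunayTri (Q : Set Pt) (t : Finset Pt) (z : Pt) (c : ℝ) : Prop where
  card : t.card = 3
  subset : (t : Set Pt) ⊆ Q
  pw_eq : ∀ p ∈ t, pw z c p = 0
  empty : ∀ q ∈ Q, 0 ≤ pw z c q

lemma exists_circumcircle {a b c : Pt} (h : orient a b c ≠ 0) :
    ∃ z r, pw z r a = 0 ∧ pw z r b = 0 ∧ pw z r c = 0 := by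
  set B := (b 0 - a 0) ^ 2 + (b 1 - a 1) ^ 2
  set C := (c 0 - a 0) ^ 2 + (c 1 - a 1) ^ 2
  set z : Pt := !₂[a 0 + (B * (c 1 - a 1) - C * (b 1 - a 1)) / (2 * orient a b c),
    a 1 + (C * (b 0 - a 0) - B * (c 0 - a 0)) / (2 * orient a b c)]
  have hz0 : z 0 = a 0 + (B * (c 1 - a 1) - C * (b 1 - a 1)) / (2 * orient a b c) := rfl
  have hz1 : z 1 = a 1 + (C * (b 0 - a 0) - B * (c 0 - a 0)) / (2 * orient a b c) := rfl
  set X := (B * (c 1 - a 1) - C * (b 1 - a 1)) / (2 * orient a b c) with hX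
  set Y := (C * (b 0 - a 0) - B * (c 0 - a 0)) / (2 * orient a b c) with hY
  have e1 : 2 * (X * (b 0 - a 0) + Y * (b 1 - a 1)) = B := by
    rw [hX, hY]; field_simp; simp only [orient]; ring
  have e2 : 2 * (X * (c 0 - a 0) + Y * (c 1 - a 1)) = C := by
    rw [hX, hY]; field_simp; simp only [orient]; ring
  refine ⟨z, X ^ 2 + Y ^ 2, ?_, ?_, ?_⟩ <;> simp only [pw, hz0, hz1]
  · ring
  · linear_combination (-1 : ℝ) * e1
  · linear_combination (-1 : ℝ) * e2

lemma GenPos.eq_of_pw_eq_zero {P : Set Pt} (hgp : GenPos P) {s t : Finset Pt} (hs : s.card = 3)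
    (ht : t.card = 3) (hsP : (s : Set Pt) ⊆ P) (htP : (t : Set Pt) ⊆ P) {z : Pt} {c : ℝ}
    (hzs : ∀ p ∈ s, pw z c p = 0) (hzt : ∀ p ∈ t, pw z c p = 0) : s = t := by
  suffices h : t ⊆ s from (Finset.eq_of_subset_of_card_le h (by rw [hs, ht])).symm
  intro q hq
  by_contra hqs
  obtain ⟨a, b, d, hab, had, hbd, rfl⟩ := Finset.card_eq_three.1 hs
  simp only [Finset.mem_insert, Finset.mem_singleton, not_or] at hqs
  refine hgp.2 a b d q (hsP (by simp)) (hsP (by simp)) (hsP (by simp)) (htP hq) hab had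
    (Ne.symm hqs.1) hbd (Ne.symm hqs.2.1) (Ne.symm hqs.2.2) ⟨z, √c, ?_⟩
  have key : ∀ p, pw z c p = 0 → dist p z = √c := fun p hp => by
    rw [← Real.sqrt_sq (dist_nonneg (x := p) (y := z)), dist_sq_eq_pw p z c, hp, zero_add]
  rintro p (rfl | rfl | rfl | rfl)
  · exact key _ (hzs _ (by simp))
  · exact key _ (hzs _ (by simp))
  · exact key _ (hzs _ (by simp))
  · exact key _ (hzt _ hq)

/-- Two Delaunay triangles of `Q` with a common interior point coincide. -/
lemma IsDelaunayTri.eq_of_interior {Q : Set Pt} (hgp : GenPos Q) {s t : Finset Pt} {z z' : Pt}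
    {c c' : ℝ} (hs : IsDelaunayTri Q s z c) (ht : IsDelaunayTri Q t z' c') {x : Pt}
    (hxs : x ∈ interior (triSet s)) (hxt : x ∈ interior (triSet t)) : s = t := by
  have hL := isAff_pw_sub z' z c' c
  have h0 : ∀ y, pw z' c' y - pw z c y = 0 := by
    refine hL.eq_zero_of_interior (fun p hp => hL.nonneg_of_mem_triSet (fun q hq => ?_) hp) hxs ?_
    · rw [hs.pw_eq q hq, sub_zero]
      exact ht.empty q (hs.subset hq)
    · have := (isAff_pw_sub z z' c c').nonneg_of_mem_triSet (t := t) (fun q hq => ?_)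
        (interior_subset hxt)
      · linarith
      · rw [ht.pw_eq q hq, sub_zero]
        exact hs.empty q (ht.subset hq)
  refine hgp.eq_of_pw_eq_zero hs.card ht.card hs.subset ht.subset hs.pw_eq fun p hp => ?_
  have := h0 p
  rw [ht.pw_eq p hp] at this
  linarith

lemma GenPos.mono {P Q : Set Pt} (h : GenPos P) (hQ : Q ⊆ P) : GenPos Q :=
  ⟨fun u v w hu hv hw => h.1 u v w (hQ hu) (hQ hv) (hQ hw),
    fun u v w z hu hv hw hz => h.2 u v w z (hQ hu) (hQ hv) (hQ hw) (hQ hz)⟩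

lemma IsGeneric.mono {P Q : Set Pt} {x : Pt} (h : IsGeneric P x) (hQ : Q ⊆ P) : IsGeneric Q x :=
  fun a ha b hb => h a (hQ ha) b (hQ hb)

lemma orderKTri_of_pw {P : Set Pt} {t : Finset Pt} {z : Pt} {c : ℝ} (hne : t.Nonempty)
    (ht : ∀ p ∈ t, pw z c p = 0) {k : ℕ} (h : {p ∈ P | pw z c p < 0}.encard ≤ (k : ℕ∞)) :
    OrderKTri P k t := by
  have hc : √c ^ 2 = c := by
    obtain ⟨p, hp⟩ := hne
    have := ht p hp
    simp only [pw] at this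
    exact Real.sq_sqrt (by nlinarith [sq_nonneg (p 0 - z 0), sq_nonneg (p 1 - z 1)])
  refine ⟨z, √c, fun p hp => ?_, ?_⟩
  · rw [dist_eq_iff_pw (Real.sqrt_nonneg _), hc, ht p hp]
  · simpa only [dist_lt_iff_pw (Real.sqrt_nonneg _), hc] using h

lemma OrderKTri.exists_pw {P : Set Pt} {t : Finset Pt} {k : ℕ} (hne : t.Nonempty)
    (h : OrderKTri P k t) : ∃ z c, (∀ p ∈ t, pw z c p = 0) ∧
      {p ∈ P | pw z c p < 0}.encard ≤ (k : ℕ∞) := by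
  obtain ⟨z, r, h1, h2⟩ := h
  have hr : 0 ≤ r := by
    obtain ⟨p, hp⟩ := hne
    exact h1 p hp ▸ dist_nonneg
  exact ⟨z, r ^ 2, fun p hp => (dist_eq_iff_pw hr).1 (h1 p hp), by
    simpa only [dist_lt_iff_pw hr] using h2⟩

lemma IsOrderDT.exists_isDelaunayTri {P : Set Pt} {T : Set (Finset Pt)} (hT : IsOrderDT P 0 T)
    {t : Finset Pt} (ht : t ∈ T) : ∃ z c, IsDelaunayTri P t z c := by
  have hcard := (hT.1.2.1 t ht).1
  obtain ⟨z, c, h1, h2⟩ := (hT.2 t ht).exists_pw (Finset.card_pos.1 (by omega))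
  refine ⟨z, c, hcard, (hT.1.2.1 t ht).2, h1, fun q hq => ?_⟩
  by_contra! hcon
  simp only [Nat.cast_zero, nonpos_iff_eq_zero, encard_eq_zero] at h2
  exact (h2 ▸ (⟨hq, hcon⟩ : q ∈ {p ∈ P | pw z c p < 0}) : q ∈ (∅ : Set Pt))

/-! ### Delaunay triangles cover the convex hull -/

lemma exists_exchange {l m : Fin 3 → ℝ} (hl : ∀ i, 0 < l i) (hm : ∑ i, m i = 1) :
    ∃ i, 0 < m i ∧ ∀ j, l i * m j ≤ l j * m i := by
  have hne : (Finset.univ.filter fun i => 0 < m i).Nonempty := by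
    by_contra hcon
    simp only [Finset.not_nonempty_iff_eq_empty, Finset.filter_eq_empty_iff, not_lt] at hcon
    have := Finset.sum_nonpos fun i (_ : i ∈ Finset.univ) => hcon (x := i) (Finset.mem_univ i)
    linarith
  obtain ⟨i, hi, hmin⟩ := Finset.exists_min_image _ (fun i => l i / m i) hne
  simp only [Finset.mem_filter, Finset.mem_univ, true_and] at hi hmin
  refine ⟨i, hi, fun j => ?_⟩
  rcases lt_or_ge 0 (m j) with h | h
  · have := hmin j h
    rwa [div_le_div_iff₀ hi h] at this
  · nlinarith [mul_nonneg (hl i).le (neg_nonneg.2 h), mul_pos (hl j) hi]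

/-- If `p` lies in the open circumdisk of `a b c`, then one of the vertices can be exchanged for
`p` so that the new triangle still contains `x` and the power of `x` increases. -/
lemma exchange_step {a b c p x : Pt} {l m n l' m' n' : ℝ} (hl : 0 < l)
    (hs : l + m + n = 1) (hx : ∀ i, x i = l * a i + m * b i + n * c i)
    (hs' : l' + m' + n' = 1) (hp : ∀ i, p i = l' * a i + m' * b i + n' * c i) (hl' : 0 < l')
    (hm : l * m' ≤ m * l') (hn : l * n' ≤ n * l') {z : Pt} {r : ℝ}
    (hb : pw z r b = 0) (hc : pw z r c = 0) (hpz : pw z r p < 0) :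
    x ∈ triSet {p, b, c} ∧ ∀ z' r', (∀ q ∈ ({p, b, c} : Finset Pt), pw z' r' q = 0) →
      pw z r x < pw z' r' x := by
  have h1 : 0 ≤ m - l / l' * m' := by
    rw [sub_nonneg, div_mul_eq_mul_div, div_le_iff₀ hl']; linarith
  have h2 : 0 ≤ n - l / l' * n' := by
    rw [sub_nonneg, div_mul_eq_mul_div, div_le_iff₀ hl']; linarith
  have hsum : l / l' + (m - l / l' * m') + (n - l / l' * n') = 1 := by
    field_simp; linear_combination l' * hs - l * hs'
  have hx' : ∀ i, x i = l / l' * p i + (m - l / l' * m') * b i + (n - l / l' * n') * c i := by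
    intro i; rw [hx, hp]; field_simp; ring
  refine ⟨mem_triSet_iff.2 ⟨l / l', _, _, by positivity, h1, h2, hsum, hx'⟩, fun z' r' hz' => ?_⟩
  have hpz' := hz' p (by simp)
  have hb' := hz' b (by simp)
  have hc' := hz' c (by simp)
  have hpos : 0 < l / l' := by positivity
  generalize l / l' = e at *
  generalize m - e * m' = f at *
  generalize n - e * n' = g at *
  have key : pw z' r' x - pw z r x = e * (pw z' r' p - pw z r p) + f * (pw z' r' b - pw z r b)
      + g * (pw z' r' c - pw z r c) := by
    obtain rfl : e = 1 - f - g := by linarith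
    simp only [pw, hx']; ring
  rw [hb, hb', hc, hc', hpz'] at key
  nlinarith

/-- The Delaunay triangles of a finite set in general position cover its convex hull (up to
lines). -/
lemma GenPos.exists_isDelaunayTri {Q : Set Pt} (hgp : GenPos Q) (hQ : Q.Finite) {x : Pt}
    (hQ2 : Q.Nontrivial) (hx : IsGeneric Q x) (hxQ : x ∈ convexHull ℝ Q) :
    ∃ t z c, IsDelaunayTri Q t z c ∧ x ∈ triSet t := by
  set W : Set (Finset Pt) := {t | t.card = 3 ∧ (t : Set Pt) ⊆ Q ∧ x ∈ triSet t} with hW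
  have hWfin : W.Finite := by
    refine (hQ.toFinset.powerset.finite_toSet).subset fun t ht => ?_
    simp only [Finset.coe_powerset, mem_preimage, mem_powerset_iff, Finite.coe_toFinset]
    exact ht.2.1
  have hcirc : ∀ t : Finset Pt, ∃ z c, t ∈ W → ∀ p ∈ t, pw z c p = 0 := by
    intro t
    by_cases ht : t ∈ W
    · obtain ⟨h3, hsub, -⟩ := ht
      obtain ⟨a, b, c, hab, hac, hbc, rfl⟩ := Finset.card_eq_three.1 h3
      obtain ⟨z, r, h1, h2, h3⟩ := exists_circumcircle (hgp.orient_ne_zero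
        (hsub (show a ∈ _ by simp)) (hsub (show b ∈ _ by simp)) (hsub (show c ∈ _ by simp))
        hab hac hbc)
      refine ⟨z, r, fun _ p hp => ?_⟩
      simp only [Finset.mem_insert, Finset.mem_singleton] at hp
      rcases hp with rfl | rfl | rfl <;> assumption
    · exact ⟨0, 0, fun h => absurd h ht⟩
  choose z c hzc using hcirc
  have hWne : W.Nonempty := by
    rw [convexHull_eq_union] at hxQ
    simp only [mem_iUnion] at hxQ
    obtain ⟨t, htQ, hind, hxt⟩ := hxQ
    have hle : t.card ≤ 3 := by
      have := hind.card_le_finrank_succ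
      simp only [Fintype.card_coe] at this
      refine this.trans ?_
      have h2 := Submodule.finrank_le (vectorSpan ℝ (range ((↑) : t → Pt)))
      rw [finrank_euclideanSpace_fin] at h2
      omega
    refine ⟨t, ?_, htQ, hxt⟩
    by_contra hcon
    obtain ⟨a, ha, b, hb, hab, htab⟩ : ∃ a ∈ Q, ∃ b ∈ Q, a ≠ b ∧ ∀ p ∈ t, p = a ∨ p = b := by
      obtain h | h | h : t.card = 0 ∨ t.card = 1 ∨ t.card = 2 := by omega
      · obtain ⟨a, ha, b, hb, hab⟩ := hQ2
        exact ⟨a, ha, b, hb, hab, by simp [Finset.card_eq_zero.1 h]⟩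
      · obtain ⟨a, rfl⟩ := Finset.card_eq_one.1 h
        have ha : a ∈ Q := htQ (by simp)
        obtain ⟨b, hb, hba⟩ := hQ2.exists_ne a
        exact ⟨a, ha, b, hb, hba.symm, by simp⟩
      · obtain ⟨a, b, hab, rfl⟩ := Finset.card_eq_two.1 h
        exact ⟨a, htQ (by simp), b, htQ (by simp), hab, by simp⟩
    have h0 : ∀ p ∈ t, orient a b p = 0 := fun p hp => by
      rcases htab p hp with rfl | rfl <;> simp [orient]; ring
    have h1 := (isAff_orient a b).nonneg_of_mem_triSet (fun p hp => (h0 p hp).ge) hxt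
    have h2 := (isAff_orient a b).neg.nonneg_of_mem_triSet
      (fun p hp => by rw [h0 p hp, neg_zero]) hxt
    exact hx a ha b hb hab (by linarith)
  obtain ⟨t, htW, hmax⟩ := hWfin.exists_maximalFor (fun t => pw (z t) (c t) x) W hWne
  obtain ⟨hcard, htQ, hxt⟩ := htW
  have hzt := hzc t ⟨hcard, htQ, hxt⟩
  refine ⟨t, z t, c t, ⟨hcard, htQ, hzt, fun p hp => ?_⟩, hxt⟩
  by_contra! hneg
  suffices h : ∃ s ∈ W, pw (z t) (c t) x < pw (z s) (c s) x by
    obtain ⟨s, hs, hlt⟩ := h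
    exact absurd (hmax hs hlt.le) (not_le.2 hlt)
  have hpt : p ∉ t := fun h => by rw [hzt p h] at hneg; exact lt_irrefl _ hneg
  obtain ⟨a, b, d, hab, had, hbd, htabd⟩ := Finset.card_eq_three.1 hcard
  generalize z t = w at *
  generalize c t = r at *
  subst htabd
  have haQ : a ∈ Q := htQ (by simp)
  have hbQ : b ∈ Q := htQ (by simp)
  have hdQ : d ∈ Q := htQ (by simp)
  simp only [Finset.mem_insert, Finset.mem_singleton, not_or] at hpt
  obtain ⟨hpa, hpb, hpd⟩ := hpt
  have ho := hgp.orient_ne_zero haQ hbQ hdQ hab had hbd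
  obtain ⟨l, m, n, hl, hm, hn, hs, h⟩ := mem_triSet_iff.1 hxt
  obtain ⟨h1, h2, h3⟩ := orient_of_barycentric hs h
  replace hl := hl.lt_of_ne' fun h0 => hx b hbQ d hdQ hbd (by rw [h1, h0, zero_mul])
  replace hm := hm.lt_of_ne' fun h0 => hx d hdQ a haQ had.symm (by rw [h2, h0, zero_mul])
  replace hn := hn.lt_of_ne' fun h0 => hx a haQ b hbQ hab (by rw [h3, h0, zero_mul])
  obtain ⟨hs', hp'⟩ := orient_barycentric ho p
  generalize orient b d p / orient a b d = l' at *
  generalize orient d a p / orient a b d = m' at *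
  generalize orient a b p / orient a b d = n' at *
  have hza := hzt a (by simp)
  have hzb := hzt b (by simp)
  have hzd := hzt d (by simp)
  have key : ∀ q r' : Pt, q ∈ Q → r' ∈ Q → p ≠ q → p ≠ r' → q ≠ r' → x ∈ triSet {p, q, r'} →
      ({p, q, r'} : Finset Pt) ∈ W := by
    intro q r' hq hr' h1 h2 h3 h4
    refine ⟨Finset.card_eq_three.2 ⟨p, q, r', h1, h2, h3, rfl⟩, ?_, h4⟩
    intro y hy
    simp only [Finset.coe_insert, Finset.coe_singleton, mem_insert_iff, mem_singleton_iff] at hy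
    rcases hy with rfl | rfl | rfl <;> assumption
  obtain ⟨i, hi, hj⟩ := exists_exchange (l := ![l, m, n]) (m := ![l', m', n'])
    (by intro i; fin_cases i <;> assumption) (by simpa [Fin.sum_univ_three] using hs')
  have hj0 := hj 0
  have hj1 := hj 1
  have hj2 := hj 2
  fin_cases i <;> simp at hi hj0 hj1 hj2
  · obtain ⟨g1, g2⟩ := exchange_step hl hs h hs' hp' hi hj1 hj2 hzb hzd hneg
    have hW' := key b d hbQ hdQ hpb hpd hbd g1
    exact ⟨_, hW', g2 _ _ (hzc _ hW')⟩
  · obtain ⟨g1, g2⟩ := exchange_step (a := b) (b := d) (c := a) (l := m) (m := n) (n := l)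
      (l' := m') (m' := n') (n' := l') hm (by linarith) (fun i => by rw [h i]; ring)
      (by linarith) (fun i => by rw [hp' i]; ring) hi hj2 hj0 hzd hza hneg
    have hW' := key d a hdQ haQ hpd hpa had.symm g1
    exact ⟨_, hW', g2 _ _ (hzc _ hW')⟩
  · obtain ⟨g1, g2⟩ := exchange_step (a := d) (b := a) (c := b) (l := n) (m := l) (n := m)
      (l' := n') (m' := l') (n' := m') hn (by linarith) (fun i => by rw [h i]; ring)
      (by linarith) (fun i => by rw [hp' i]; ring) hi hj0 hj1 hza hzb hneg
    have hW' := key a b haQ hbQ hpa hpb hab g1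
    exact ⟨_, hW', g2 _ _ (hzc _ hW')⟩

/-! ### The two sides of an edge -/

/-- The points of `P` that do not lie strictly to the right of the line from `u` to `v`. -/
def leftPts (P : Set Pt) (u v : Pt) : Set Pt := {p ∈ P | 0 ≤ orient u v p}

/-- The triangles of `T` whose interior meets the segment `uv`. -/
def crossed (T : Set (Finset Pt)) (u v : Pt) : Set (Finset Pt) :=
  {t ∈ T | (interior (triSet t) ∩ segment ℝ u v).Nonempty}

/-- The union of the triangles of `T` whose interior meets the segment `uv`. -/
def hull (T : Set (Finset Pt)) (u v : Pt) : Set Pt := ⋃ t ∈ crossed T u v, triSet t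

lemma leftPts_subset (P : Set Pt) (u v : Pt) : leftPts P u v ⊆ P := sep_subset _ _

lemma crossed_comm (T : Set (Finset Pt)) (u v : Pt) : crossed T u v = crossed T v u := by
  simp only [crossed, segment_symm]

lemma hull_comm (T : Set (Finset Pt)) (u v : Pt) : hull T u v = hull T v u := by
  simp only [hull, crossed_comm]

lemma orient_self_left (u v : Pt) : orient u v u = 0 := by simp [orient]

lemma orient_self_right (u v : Pt) : orient u v v = 0 := by simp only [orient]; ring

lemma left_mem_leftPts {P : Set Pt} {u : Pt} (v : Pt) (hu : u ∈ P) : u ∈ leftPts P u v :=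
  ⟨hu, (orient_self_left u v).ge⟩

lemma right_mem_leftPts {P : Set Pt} {v : Pt} (u : Pt) (hv : v ∈ P) : v ∈ leftPts P u v :=
  ⟨hv, (orient_self_right u v).ge⟩

lemma isClosed_hull {T : Set (Finset Pt)} (hT : T.Finite) (u v : Pt) : IsClosed (hull T u v) :=
  (hT.subset (sep_subset _ _)).isClosed_biUnion fun t _ => isClosed_triSet t

/-- A line through two points outside a disk meets the disk only between them, provided the disk
contains a point between them. -/
lemma mem_segment_of_pw_neg {u v y y' z : Pt} {c : ℝ} (huv : u ≠ v) (hu : 0 ≤ pw z c u)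
    (hv : 0 ≤ pw z c v) (hy : y ∈ segment ℝ u v) (hyz : pw z c y < 0) (hy' : orient u v y' = 0)
    (hyz' : pw z c y' < 0) : y' ∈ segment ℝ u v := by
  obtain ⟨s', rfl⟩ := collinear_of_orient_eq_zero huv hy'
  rw [segment_eq_image_lineMap] at hy ⊢
  obtain ⟨s, ⟨h0, h1⟩, rfl⟩ := hy
  refine ⟨s', ⟨?_, ?_⟩, rfl⟩
  · by_contra! hlt
    have hd : 0 < s - s' := by linarith
    have hu' : u = AffineMap.lineMap (AffineMap.lineMap u v s : Pt)
        (AffineMap.lineMap u v s' : Pt) (s / (s - s')) := by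
      apply pt_ext <;> simp only [lineMap_coord] <;> field_simp <;> ring
    rcases h0.eq_or_lt with rfl | h0
    · rw [AffineMap.lineMap_apply_zero] at hyz
      linarith
    rw [hu'] at hu
    exact absurd hu (not_le.2 (pw_lineMap_neg_of_right (by positivity)
      (by rw [div_le_one hd]; linarith) hyz.le hyz'))
  · by_contra! hlt
    have hd : 0 < s' - s := by linarith
    have hv' : v = AffineMap.lineMap (AffineMap.lineMap u v s : Pt)
        (AffineMap.lineMap u v s' : Pt) ((1 - s) / (s' - s)) := by
      apply pt_ext <;> simp only [lineMap_coord] <;> field_simp <;> ring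
    rcases h1.eq_or_lt with rfl | h1
    · rw [AffineMap.lineMap_apply_one] at hyz
      linarith
    have h1' : 0 < 1 - s := by linarith
    rw [hv'] at hv
    exact absurd hv (not_le.2 (pw_lineMap_neg_of_right (by positivity)
      (by rw [div_le_one hd]; linarith) hyz.le hyz'))

/-- An affine function of opposite signs at `x` and `b` vanishes strictly between them. -/
lemma IsAff.exists_lineMap_eq_zero {L : Pt → ℝ} (hL : IsAff L) {x b : Pt} (hx : 0 < L x)
    (hb : L b < 0) : ∃ s : ℝ, 0 < s ∧ s < 1 ∧ L (AffineMap.lineMap x b s) = 0 := by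
  have hd : 0 < L x - L b := by linarith
  refine ⟨L x / (L x - L b), by positivity, by rw [div_lt_one hd]; linarith, ?_⟩
  rw [hL]; field_simp; ring

lemma interior_triSet_lineMap {t : Finset Pt} {x b : Pt} (hx : x ∈ interior (triSet t))
    (hb : b ∈ triSet t) {s : ℝ} (h0 : 0 < s) (h1 : s < 1) :
    AffineMap.lineMap x b s ∈ interior (triSet t) := by
  have hc : Convex ℝ (triSet t) := convex_convexHull ℝ _
  refine hc.openSegment_interior_self_subset_interior hx hb ?_
  rw [openSegment_eq_image_lineMap]
  exact ⟨s, ⟨h0, h1⟩, rfl⟩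

lemma IsDelaunayTri.orient_pos {P : Set Pt} {u v : Pt} (huv : u ≠ v) {t : Finset Pt} {z : Pt}
    {c : ℝ} (ht : IsDelaunayTri (leftPts P u v) t z c) {x : Pt} (hx : x ∈ interior (triSet t)) :
    0 < orient u v x := by
  by_contra! hle
  have h0 := (isAff_orient u v).eq_zero_of_interior
    (fun p hp => (isAff_orient u v).nonneg_of_mem_triSet (fun q hq => (ht.subset hq).2) hp) hx hle
  obtain ⟨w, hw⟩ := (dense_orient_ne_zero huv).nonempty
  exact hw (h0 w)

/-- A triangle of the Delaunay triangulation of `P` overlapping a Delaunay triangle of the points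
to the left of `uv` whose open circumdisk is not empty crosses the line `uv` inside this disk. -/
lemma IsDelaunayTri.exists_crossing {P : Set Pt} {u v : Pt} (huv : u ≠ v) {t e : Finset Pt}
    {z z' : Pt} {c c' : ℝ} (ht : IsDelaunayTri (leftPts P u v) t z c)
    (he : IsDelaunayTri P e z' c') {x : Pt} (hxt : x ∈ interior (triSet t))
    (hxe : x ∈ interior (triSet e)) {p : Pt} (hp : p ∈ P) (hpz : pw z c p < 0) :
    ∃ y, orient u v y = 0 ∧ y ∈ interior (triSet e) ∧ pw z c y < 0 := by
  have hL := isAff_pw_sub z' z c' c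
  have hLx : 0 < pw z' c' x - pw z c x := by
    by_contra! hle
    have := hL.eq_zero_of_interior (A := triSet t) (fun q hq =>
      hL.nonneg_of_mem_triSet (fun q hq => by
        rw [ht.pw_eq q hq, sub_zero]; exact he.empty q (ht.subset hq).1) hq) hxt hle p
    have := he.empty p hp
    linarith
  obtain ⟨b, hbe, hb⟩ : ∃ b ∈ e, pw z c b < 0 := by
    by_contra! hcon
    have := (isAff_pw_sub z z' c c').nonneg_of_mem_triSet (fun q hq => by
      rw [he.pw_eq q hq, sub_zero]; exact hcon q hq) (interior_subset hxe)
    linarith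
  have hbl : orient u v b < 0 := by
    by_contra! hcon
    exact absurd (ht.empty b ⟨he.subset hbe, hcon⟩) (not_le.2 hb)
  obtain ⟨s, h0, h1, hs⟩ :=
    (isAff_orient u v).exists_lineMap_eq_zero (ht.orient_pos huv hxt) hbl
  exact ⟨_, hs, interior_triSet_lineMap hxe (subset_convexHull ℝ _ hbe) h0 h1,
    pw_lineMap_neg_of_right h0 h1.le (interior_triSet_pw_neg ht.pw_eq hxt).le hb⟩

lemma IsTriangulation.exists_mem_interior {P : Set Pt} {T : Set (Finset Pt)}
    (hT : IsTriangulation P T) {x : Pt} (hx : IsGeneric P x) (hxP : x ∈ convexHull ℝ P) :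
    ∃ e ∈ T, x ∈ interior (triSet e) := by
  rw [← hT.2.2.2.2] at hxP
  simp only [mem_iUnion] at hxP
  obtain ⟨e, he, hxe⟩ := hxP
  exact ⟨e, he, hx.mem_interior (hT.2.1 e he).1 (hT.2.1 e he).2 hxe⟩

section Sides

variable {P : Set Pt} {T : Set (Finset Pt)} {u v : Pt}

lemma IsDelaunayTri.subset_hull_of_chord (hfin : P.Finite) (hgp : GenPos P) (huv : u ≠ v)
    (hT : IsOrderDT P 0 T) {t : Finset Pt} {z : Pt} {c : ℝ}
    (ht : IsDelaunayTri (leftPts P u v) t z c) {p : Pt} (hp : p ∈ P) (hpz : pw z c p < 0)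
    (hchord : ∀ y, orient u v y = 0 → pw z c y < 0 → y ∈ segment ℝ u v) :
    triSet t ⊆ hull T u v := by
  have htP := ht.subset.trans (leftPts_subset P u v)
  refine hgp.triSet_subset_of_isGeneric hfin ht.card htP (isClosed_hull hT.1.1 u v) ?_
  intro x hx hgen
  obtain ⟨e, heT, hxe⟩ := hT.1.exists_mem_interior hgen
    (convexHull_mono htP (interior_subset hx))
  obtain ⟨z', c', he⟩ := hT.exists_isDelaunayTri heT
  obtain ⟨y, hy, hye, hyz⟩ := ht.exists_crossing huv he hx hxe hp hpz
  exact mem_biUnion (⟨heT, y, hye, hchord y hy hyz⟩ : e ∈ crossed T u v) (interior_subset hxe)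

lemma IsDelaunayTri.subset_hull_of_interior (hfin : P.Finite) (hgp : GenPos P) (huv : u ≠ v)
    (hu : u ∈ P) (hv : v ∈ P) (hT : IsOrderDT P 0 T) {t : Finset Pt} {z : Pt} {c : ℝ}
    (ht : IsDelaunayTri (leftPts P u v) t z c) {d : Finset Pt} (hd : d ∈ crossed T u v) {x : Pt}
    (hxt : x ∈ interior (triSet t)) (hxd : x ∈ interior (triSet d)) :
    triSet t ⊆ hull T u v ∧ (IsDelaunayTri P t z c ∨
      ∀ y, orient u v y = 0 → pw z c y < 0 → y ∈ segment ℝ u v) := by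
  obtain ⟨hdT, w, hwd, hw⟩ := hd
  obtain ⟨z', c', hd⟩ := hT.exists_isDelaunayTri hdT
  by_cases hp : ∃ p ∈ P, pw z c p < 0
  · obtain ⟨p, hp, hpz⟩ := hp
    obtain ⟨y, hy, hyd, hyz⟩ := ht.exists_crossing huv hd hxt hxd hp hpz
    have hyuv := mem_segment_of_pw_neg huv (hd.empty u hu) (hd.empty v hv) hw
      (interior_triSet_pw_neg hd.pw_eq hwd) hy (interior_triSet_pw_neg hd.pw_eq hyd)
    have hchord : ∀ y, orient u v y = 0 → pw z c y < 0 → y ∈ segment ℝ u v := fun y' =>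
      mem_segment_of_pw_neg huv (ht.empty u (left_mem_leftPts v hu))
        (ht.empty v (right_mem_leftPts u hv)) hyuv hyz
    exact ⟨ht.subset_hull_of_chord hfin hgp huv hT hp hpz hchord, Or.inr hchord⟩
  · push Not at hp
    have htP : IsDelaunayTri P t z c :=
      ⟨ht.card, ht.subset.trans (leftPts_subset P u v), ht.pw_eq, hp⟩
    obtain rfl := htP.eq_of_interior hgp hd hxt hxd
    exact ⟨subset_biUnion_of_mem (u := triSet) (⟨hdT, w, hwd, hw⟩ : t ∈ crossed T u v),
      Or.inl htP⟩

lemma mem_convexHull_leftPts (hfin : P.Finite) (huv : u ≠ v) (hu : u ∈ P) (hv : v ∈ P)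
    (hT : IsOrderDT P 0 T) {d : Finset Pt} (hd : d ∈ crossed T u v) {x : Pt}
    (hxd : x ∈ interior (triSet d)) (hx : 0 < orient u v x) :
    x ∈ convexHull ℝ (leftPts P u v) := by
  obtain ⟨hdT, w, hwd, hw⟩ := hd
  obtain ⟨z, c, hd⟩ := hT.exists_isDelaunayTri hdT
  by_contra hcon
  obtain ⟨f, r, hf, hfx⟩ := geometric_hahn_banach_closed_point (convex_convexHull ℝ _)
    (((hfin.subset (leftPts_subset P u v)).isCompact_convexHull ℝ).isClosed) hcon
  replace hf := fun p hp => hf p (subset_convexHull ℝ _ hp)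
  obtain ⟨b, hbd, hb⟩ : ∃ b ∈ d, r < f b := by
    by_contra! hle
    have : triSet d ⊆ {y | f y ≤ r} :=
      convexHull_min (fun p hp => hle p hp) (convex_halfSpace_le f.toLinearMap.isLinear r)
    exact absurd (this (interior_subset hxd)) (not_le.2 hfx)
  have hbl : orient u v b < 0 := by
    by_contra! h
    exact absurd (hf b ⟨hd.subset hbd, h⟩) (not_lt.2 hb.le)
  obtain ⟨s, h0, h1, hs⟩ := (isAff_orient u v).exists_lineMap_eq_zero hx hbl
  have hy := interior_triSet_lineMap hxd (subset_convexHull ℝ _ hbd) h0 h1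
  have hyuv := mem_segment_of_pw_neg huv (hd.empty u hu) (hd.empty v hv) hw
      (interior_triSet_pw_neg hd.pw_eq hwd) hs (interior_triSet_pw_neg hd.pw_eq hy)
  have hle : f (AffineMap.lineMap x b s) < r :=
    (convex_halfSpace_lt f.toLinearMap.isLinear r).segment_subset
      (hf u (left_mem_leftPts v hu)) (hf v (right_mem_leftPts u hv)) hyuv
  rw [AffineMap.lineMap_apply_module, map_add, map_smul, map_smul, smul_eq_mul, smul_eq_mul] at hle
  nlinarith

lemma exists_isDelaunayTri_of_mem_hull (hfin : P.Finite) (hgp : GenPos P) (huv : u ≠ v)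
    (hu : u ∈ P) (hv : v ∈ P) (hT : IsOrderDT P 0 T) {d : Finset Pt} (hd : d ∈ crossed T u v)
    {x : Pt} (hgen : IsGeneric P x) (hxd : x ∈ interior (triSet d)) (hx : 0 < orient u v x) :
    ∃ t z c, IsDelaunayTri (leftPts P u v) t z c ∧ triSet t ⊆ hull T u v ∧ x ∈ triSet t := by
  obtain ⟨t, z, c, ht, hxt⟩ := (hgp.mono (leftPts_subset P u v)).exists_isDelaunayTri
    (hfin.subset (leftPts_subset P u v)) ⟨u, left_mem_leftPts v hu, v, right_mem_leftPts u hv, huv⟩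
    (hgen.mono (leftPts_subset P u v)) (mem_convexHull_leftPts hfin huv hu hv hT hd hxd hx)
  refine ⟨t, z, c, ht, (ht.subset_hull_of_interior hfin hgp huv hu hv hT hd ?_ hxd).1, hxt⟩
  exact hgen.mem_interior ht.card (ht.subset.trans (leftPts_subset P u v)) hxt

lemma IsDelaunayTri.exists_orient_pos (hgp : GenPos P) (huv : u ≠ v) (hu : u ∈ P) (hv : v ∈ P)
    {t : Finset Pt} {z : Pt} {c : ℝ} (ht : IsDelaunayTri (leftPts P u v) t z c) :
    ∃ a ∈ t, 0 < orient u v a := by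
  obtain ⟨a, ha, hau⟩ : ∃ a ∈ t, a ∉ ({u, v} : Finset Pt) := by
    by_contra! hcon
    have := Finset.card_le_card (show t ⊆ {u, v} from hcon)
    rw [ht.card] at this
    exact absurd (this.trans Finset.card_le_two) (by norm_num)
  simp only [Finset.mem_insert, Finset.mem_singleton, not_or] at hau
  exact ⟨a, ha, (ht.subset ha).2.lt_of_ne'
    (hgp.orient_ne_zero hu hv (ht.subset ha).1 huv (Ne.symm hau.1) (Ne.symm hau.2))⟩

/-- The open circumdisk of a Delaunay triangle of the points to the left of `uv`, whose chord on
the line `uv` is contained in the segment `uv`, contains no more points than the circumdisk of the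
Delaunay triangle at `uv`. -/
lemma IsDelaunayTri.pw_neg_of_chord (hgp : GenPos P) (huv : u ≠ v) (hu : u ∈ P) (hv : v ∈ P)
    {t t₀ : Finset Pt} {z z₀ : Pt}
    {c c₀ : ℝ} (ht : IsDelaunayTri (leftPts P u v) t z c)
    (ht₀ : IsDelaunayTri (leftPts P u v) t₀ z₀ c₀) (hut₀ : u ∈ t₀) (hvt₀ : v ∈ t₀)
    (hchord : ∀ y, orient u v y = 0 → pw z c y < 0 → y ∈ segment ℝ u v) {p : Pt} (hp : p ∈ P)
    (hpz : pw z c p < 0) : pw z₀ c₀ p < 0 := by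
  have hpl : orient u v p < 0 := by
    by_contra! h
    exact absurd (ht.empty p ⟨hp, h⟩) (not_le.2 hpz)
  obtain ⟨a, ha, hal⟩ := ht.exists_orient_pos hgp huv hu hv
  obtain ⟨s, h0, h1, hs⟩ := (isAff_orient u v).exists_lineMap_eq_zero hal hpl
  have hy := hchord _ hs (pw_lineMap_neg_of_right h0 h1.le (ht.pw_eq a ha).le hpz)
  have hL := isAff_pw_sub z z₀ c c₀
  have hLy := hL.convex_nonneg.segment_subset (x := u) (y := v)
    (by rw [mem_ofPred_eq, ht₀.pw_eq u hut₀, sub_zero]; exact ht.empty u (left_mem_leftPts v hu))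
    (by rw [mem_ofPred_eq, ht₀.pw_eq v hvt₀, sub_zero]; exact ht.empty v (right_mem_leftPts u hv))
    hy
  have hLs := hL a p s
  simp only [mem_ofPred_eq, ht.pw_eq a ha] at hLy hLs
  rw [hLs] at hLy
  have ha₀ := ht₀.empty a (ht.subset ha)
  nlinarith

/-- Among the circles through `u`, `v` and a point of `P` strictly to the left of `uv`, one has no
point of `P` on the left in its interior. -/
lemma exists_isDelaunayTri_edge (hfin : P.Finite) (hgp : GenPos P) (huv : u ≠ v) (hu : u ∈ P)
    (hv : v ∈ P) {q : Pt} (hq : q ∈ P) (hql : 0 < orient u v q) :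
    ∃ s z c, 0 < orient u v s ∧ IsDelaunayTri (leftPts P u v) {u, v, s} z c := by
  set W : Set Pt := {p ∈ P | 0 < orient u v p}
  obtain ⟨s, ⟨hsP, hs⟩, hmin⟩ := (hfin.subset (sep_subset P _)).exists_minimalFor (fun p : Pt =>
    ((p 0 - u 0) * (p 0 - v 0) + (p 1 - u 1) * (p 1 - v 1)) / orient u v p) W ⟨q, hq, hql⟩
  set l := ((s 0 - u 0) * (s 0 - v 0) + (s 1 - u 1) * (s 1 - v 1)) / orient u v s with hl
  set z : Pt := !₂[(u 0 + v 0) / 2 - l / 2 * (v 1 - u 1), (u 1 + v 1) / 2 + l / 2 * (v 0 - u 0)]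
  have hz0 : z 0 = (u 0 + v 0) / 2 - l / 2 * (v 1 - u 1) := rfl
  have hz1 : z 1 = (u 1 + v 1) / 2 + l / 2 * (v 0 - u 0) := rfl
  have hpw : ∀ x, pw z ((u 0 - z 0) ^ 2 + (u 1 - z 1) ^ 2) x =
      (x 0 - u 0) * (x 0 - v 0) + (x 1 - u 1) * (x 1 - v 1) - l * orient u v x := by
    intro x; simp only [pw, hz0, hz1, orient]; ring
  have hsu : s ≠ u := by rintro rfl; rw [orient_self_left] at hs; exact lt_irrefl _ hs
  have hsv : s ≠ v := by rintro rfl; rw [orient_self_right] at hs; exact lt_irrefl _ hs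
  refine ⟨s, z, (u 0 - z 0) ^ 2 + (u 1 - z 1) ^ 2, hs,
    Finset.card_eq_three.2 ⟨u, v, s, huv, hsu.symm, hsv.symm, rfl⟩, ?_, ?_, ?_⟩
  · intro p hp
    simp only [Finset.coe_insert, Finset.coe_singleton, mem_insert_iff, mem_singleton_iff] at hp
    rcases hp with rfl | rfl | rfl
    exacts [left_mem_leftPts _ hu, right_mem_leftPts _ hv, ⟨hsP, hs.le⟩]
  · intro p hp
    simp only [Finset.mem_insert, Finset.mem_singleton] at hp
    rw [hpw]
    rcases hp with rfl | rfl | rfl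
    · rw [orient_self_left]; ring
    · rw [orient_self_right]; ring
    · rw [hl, div_mul_cancel₀ _ hs.ne', sub_self]
  · rintro p ⟨hp, hpl⟩
    rw [hpw]
    rcases hpl.eq_or_lt with h0 | hpos
    · by_cases hpu : p = u
      · subst hpu; rw [orient_self_left]; simp
      by_cases hpv : p = v
      · subst hpv; rw [orient_self_right]; simp
      exact absurd h0.symm (hgp.orient_ne_zero hu hv hp huv (Ne.symm hpu) (Ne.symm hpv))
    · have hle : l ≤ ((p 0 - u 0) * (p 0 - v 0) + (p 1 - u 1) * (p 1 - v 1)) / orient u v p := by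
        by_contra! hlt
        exact absurd (hmin ⟨hp, hpos⟩ hlt.le) (not_le.2 hlt)
      rw [le_div_iff₀ hpos] at hle
      linarith

end Sides

/-! ### The circle through an edge and a vertex of a higher order triangulation -/

lemma GenPos.orient_ne_zero_of_card {P : Set Pt} (hgp : GenPos P) {a b c : Pt}
    (hcard : ({a, b, c} : Finset Pt).card = 3) (hP : (({a, b, c} : Finset Pt) : Set Pt) ⊆ P) :
    orient a b c ≠ 0 := by
  have h2 : ∀ x y : Pt, ({x, y} : Finset Pt).card ≠ 3 := fun x y =>
    (Finset.card_le_two.trans_lt (by norm_num)).ne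
  refine hgp.orient_ne_zero (hP (by simp)) (hP (by simp)) (hP (by simp)) ?_ ?_ ?_ <;> rintro rfl
  · exact h2 _ _ (by simpa using hcard)
  · exact h2 _ _ (by simpa [Finset.insert_comm] using hcard)
  · exact h2 _ _ (by simpa using hcard)

/-- Two edges of a triangulation do not cross. -/
lemma IsTriangulation.lineMap_ne {P : Set Pt} {T : Set (Finset Pt)} (hgp : GenPos P)
    (hT : IsTriangulation P T) {t t' : Finset Pt} (ht : t ∈ T) (ht' : t' ∈ T) {u v s b : Pt}
    (huv : u ≠ v) (hut : u ∈ t) (hvt : v ∈ t) (hst : s ∈ t') (hbt : b ∈ t') {σ r : ℝ}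
    (hσ : 0 < σ) (hσ' : σ < 1) (hr : 0 < r) (hr' : r < 1) (hs : 0 < orient u v s) :
    (AffineMap.lineMap u v σ : Pt) ≠ AffineMap.lineMap s b r := by
  intro h
  obtain ⟨w, rfl⟩ : ∃ w, t = {u, v, w} := by
    obtain ⟨w, hw⟩ := Finset.card_eq_one.1 (show ((t.erase u).erase v).card = 1 by
      rw [Finset.card_erase_of_mem (Finset.mem_erase.2 ⟨huv.symm, hvt⟩),
        Finset.card_erase_of_mem hut, (hT.2.1 t ht).1])
    refine ⟨w, ?_⟩
    rw [← hw, Finset.insert_erase (Finset.mem_erase.2 ⟨huv.symm, hvt⟩), Finset.insert_erase hut]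
  have hcard := (hT.2.1 _ ht).1
  have hD : orient u v w ≠ 0 := hgp.orient_ne_zero_of_card hcard (hT.2.1 _ ht).2
  set y : Pt := AffineMap.lineMap u v σ with hy
  have hb : orient u v b < 0 := by
    have h1 := isAff_orient u v u v σ
    have h2 := isAff_orient u v s b r
    rw [← hy, orient_self_left, orient_self_right] at h1
    rw [← h, h1] at h2
    nlinarith [mul_pos (sub_pos.2 hr') hs]
  have hyt : y ∈ triSet t' := by
    rw [h]
    exact (convex_convexHull ℝ _).lineMap_mem (subset_convexHull ℝ _ hst)
      (subset_convexHull ℝ _ hbt) ⟨hr.le, hr'.le⟩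
  obtain ⟨q, hqt, hq⟩ : ∃ q ∈ t', 0 < orient u v q / orient u v w := by
    rcases hD.lt_or_gt with hD | hD
    exacts [⟨b, hbt, div_pos_of_neg_of_neg hb hD⟩, ⟨s, hst, div_pos hs hD⟩]
  have hU : {x | 0 < orient v w x / orient u v w} ∩ {x | 0 < orient w u x / orient u v w}
      ∈ nhds y := by
    refine IsOpen.mem_nhds ?_ ⟨?_, ?_⟩
    · exact (isOpen_lt continuous_const ((continuous_orient _ _).div_const _)).inter
        (isOpen_lt continuous_const ((continuous_orient _ _).div_const _))
    · have : orient v w y = (1 - σ) * orient u v w := by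
        simp only [hy, orient, lineMap_coord]; ring
      rw [mem_ofPred_eq, this, mul_div_cancel_right₀ _ hD]
      linarith
    · have : orient w u y = σ * orient u v w := by
        simp only [hy, orient, lineMap_coord]; ring
      rw [mem_ofPred_eq, this, mul_div_cancel_right₀ _ hD]
      exact hσ
  obtain ⟨e, he, he1, ⟨h1, h2⟩, -⟩ := exists_lineMap_mem_nhds hU q
  have h3 : 0 < orient u v (AffineMap.lineMap y q e) / orient u v w := by
    have h1 := isAff_orient u v u v σ
    rw [← hy, orient_self_left, orient_self_right] at h1
    rw [isAff_orient u v, h1, mul_zero, mul_zero, add_zero, mul_zero, zero_add, mul_div_assoc]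
    positivity
  obtain ⟨g1, g2⟩ := orient_barycentric hD (AffineMap.lineMap y q e)
  obtain rfl := hT.eq_of_interior_of_mem hgp ht ht' (mem_interior_triSet hD h1 h2 h3 g1 g2)
    ((convex_convexHull ℝ _).lineMap_mem hyt (subset_convexHull ℝ _ hqt) ⟨he.le, he1.le⟩)
  simp only [Finset.mem_insert, Finset.mem_singleton] at hst hbt
  rcases hst with rfl | rfl | rfl
  · rw [orient_self_left] at hs; exact lt_irrefl _ hs
  · rw [orient_self_right] at hs; exact lt_irrefl _ hs
  rcases hbt with rfl | rfl | rfl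
  · rw [orient_self_left] at hb; exact lt_irrefl _ hb
  · rw [orient_self_right] at hb; exact lt_irrefl _ hb
  · exact lt_asymm hs hb

lemma IsTriangulation.exists_lineMap_mem {P : Set Pt} {T : Set (Finset Pt)} (hgp : GenPos P)
    (hT : IsTriangulation P T) {s x : Pt} (hs : s ∈ P) (hx : x ∈ convexHull ℝ P) :
    ∃ t ∈ T, s ∈ t ∧ ∃ e : ℝ, 0 < e ∧ AffineMap.lineMap s x e ∈ triSet t := by
  have hU : (⋃ t ∈ {t ∈ T | s ∉ triSet t}, triSet t)ᶜ ∈ nhds s := by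
    refine IsOpen.mem_nhds ?_ ?_
    · exact ((hT.1.subset (sep_subset _ _)).isClosed_biUnion fun t _ =>
        isClosed_triSet t).isOpen_compl
    · simp only [mem_compl_iff, mem_iUnion, not_exists]
      exact fun t ht => ht.2
  obtain ⟨e, he, he1, h1, -⟩ := exists_lineMap_mem_nhds hU x
  have hmem : (AffineMap.lineMap s x e : Pt) ∈ convexHull ℝ P :=
    (convex_convexHull ℝ _).lineMap_mem (subset_convexHull ℝ _ hs) hx ⟨he.le, he1.le⟩
  rw [← hT.2.2.2.2] at hmem
  simp only [mem_iUnion] at hmem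
  obtain ⟨t, ht, hmem⟩ := hmem
  refine ⟨t, ht, hT.mem_of_mem_triSet hgp ht hs ?_, e, he, hmem⟩
  by_contra hcon
  exact h1 (mem_biUnion (⟨ht, hcon⟩ : t ∈ {t ∈ T | s ∉ triSet t}) hmem)

/-- A segment leaving the quadrant `0 ≤ f, g` passes through its boundary. -/
lemma exists_quadrant_boundary {f g f' g' : ℝ} (hf : 0 ≤ f) (hg : 0 ≤ g) (h : f' < 0 ∨ g' < 0) :
    ∃ e : ℝ, 0 ≤ e ∧ e < 1 ∧ 0 ≤ (1 - e) * f + e * f' ∧ 0 ≤ (1 - e) * g + e * g' ∧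
      ((1 - e) * f + e * f' = 0 ∨ (1 - e) * g + e * g' = 0) := by
  wlog hle : f' < 0 ∧ f * (g - g') ≤ g * (f - f') generalizing f g f' g' with H
  · have hg' : g' < 0 := by
      by_contra! hg'
      have hf' := h.resolve_right hg'.not_gt
      exact hle ⟨hf', by nlinarith⟩
    have : g' < 0 ∧ g * (f - f') ≤ f * (g - g') := by
      refine ⟨hg', ?_⟩
      by_cases hf' : f' < 0
      · exact (not_le.1 fun h => hle ⟨hf', h⟩).le
      · nlinarith
    obtain ⟨e, h0, h1, h2, h3, h4⟩ := H hg hf h.symm this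
    exact ⟨e, h0, h1, h3, h2, h4.symm⟩
  obtain ⟨hf', hle⟩ := hle
  have hd : 0 < f - f' := by linarith
  have h0 : (1 - f / (f - f')) * f + f / (f - f') * f' = 0 := by field_simp; ring
  refine ⟨f / (f - f'), by positivity, by rw [div_lt_one hd]; linarith, h0.ge, ?_, Or.inl h0⟩
  have : (1 - f / (f - f')) * g + f / (f - f') * g' = (g * (f - f') - f * (g - g')) / (f - f') := by
    field_simp; ring
  rw [this]
  exact div_nonneg (by linarith) hd.le

/-- A segment from `s` into the open circumdisk of `{u, v, s}` across `uv` crosses the open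
segment `uv`. -/
lemma IsDelaunayTri.exists_lineMap_eq {P : Set Pt} {u v s z : Pt} {c : ℝ} (huv : u ≠ v)
    (ht : IsDelaunayTri (leftPts P u v) {u, v, s} z c) (hs : 0 < orient u v s) {p : Pt}
    (hp : p ∈ P) (hpz : pw z c p < 0) : ∃ σ r : ℝ, 0 < σ ∧ σ < 1 ∧ 0 < r ∧ r < 1 ∧
      (AffineMap.lineMap u v σ : Pt) = AffineMap.lineMap s p r := by
  have hpl : orient u v p < 0 := by
    by_contra! h
    exact absurd (ht.empty p ⟨hp, h⟩) (not_le.2 hpz)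
  obtain ⟨r, h0, h1, hr⟩ := (isAff_orient u v).exists_lineMap_eq_zero hs hpl
  obtain ⟨σ, hσ⟩ := collinear_of_orient_eq_zero huv hr
  have hneg := pw_lineMap_neg_of_right h0 h1.le (ht.pw_eq s (by simp)).le hpz
  rw [hσ, pw_lineMap, ht.pw_eq u (by simp), ht.pw_eq v (by simp)] at hneg
  have hpos : 0 < σ * (1 - σ) := by
    by_contra! hle
    nlinarith [add_nonneg (sq_nonneg (u 0 - v 0)) (sq_nonneg (u 1 - v 1))]
  refine ⟨σ, r, ?_, ?_, h0, h1, hσ.symm⟩ <;> by_contra! hle <;> nlinarith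

lemma IsAff.barycentric {L : Pt → ℝ} (hL : IsAff L) {a b c x : Pt} {l m n : ℝ}
    (hs : l + m + n = 1) (hx : ∀ i, x i = l * a i + m * b i + n * c i) :
    L x = l * L a + m * L b + n * L c := by
  obtain rfl : l = 1 - m - n := by linarith
  have hx' : x = AffineMap.lineMap (AffineMap.lineMap a b (2 * m) : Pt)
      (AffineMap.lineMap a c (2 * n) : Pt) (1 / 2 : ℝ) := by
    apply pt_ext <;> simp only [lineMap_coord, hx] <;> ring
  rw [hx', hL, hL, hL]; ring

/-- If `uv` is an edge of an order-`k` triangulation, then the circumcircle of the Delaunay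
triangle at `uv` on the left contains at most `k` points. -/
lemma IsDelaunayTri.encard_le {P : Set Pt} {u v s z₀ : Pt} {c₀ : ℝ} (hgp : GenPos P) (huv : u ≠ v)
    (ht₀ : IsDelaunayTri (leftPts P u v) {u, v, s} z₀ c₀) (hs : 0 < orient u v s)
    {T : Set (Finset Pt)} {k : ℕ} (hT : IsOrderDT P k T) {t₁ : Finset Pt} (ht₁ : t₁ ∈ T)
    (hut : u ∈ t₁) (hvt : v ∈ t₁) : {p ∈ P | pw z₀ c₀ p < 0}.encard ≤ (k : ℕ∞) := by
  have hsP : s ∈ P := (ht₀.subset (show s ∈ _ by simp)).1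
  have hs₀ : pw z₀ c₀ s = 0 := ht₀.pw_eq s (by simp)
  have hm : (AffineMap.lineMap u v (1 / 2 : ℝ) : Pt) ∈ convexHull ℝ P :=
    (convex_convexHull ℝ _).lineMap_mem (subset_convexHull ℝ _ ((hT.1.2.1 t₁ ht₁).2 hut))
      (subset_convexHull ℝ _ ((hT.1.2.1 t₁ ht₁).2 hvt)) ⟨by norm_num, by norm_num⟩
  obtain ⟨t, ht, hst, e, he, het⟩ := hT.1.exists_lineMap_mem hgp hsP hm
  have hτ : ∀ q ∈ t, 0 ≤ pw z₀ c₀ q := by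
    intro q hq
    by_contra! hneg
    obtain ⟨σ, r, h1, h2, h3, h4, h5⟩ :=
      ht₀.exists_lineMap_eq huv hs ((hT.1.2.1 t ht).2 hq) hneg
    exact hT.1.lineMap_ne hgp ht₁ ht huv hut hvt hst hq h1 h2 h3 h4 hs h5
  have hedge : ∀ b ∈ t, ∀ σ r : ℝ, 0 < σ → σ < 1 → 0 ≤ r →
      (AffineMap.lineMap u v σ : Pt) ≠ AffineMap.lineMap s b r := by
    intro b hb σ r h1 h2 h3 h4
    rcases h3.eq_or_lt with rfl | h3
    · rw [AffineMap.lineMap_apply_zero] at h4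
      rw [← h4, isAff_orient u v, orient_self_left, orient_self_right] at hs
      simp at hs
    rcases lt_or_ge r 1 with hr | hr
    · exact hT.1.lineMap_ne hgp ht₁ ht huv hut hvt hst hb h1 h2 h3 hr hs h4
    · have hb' : b = AffineMap.lineMap s (AffineMap.lineMap u v σ : Pt) (1 / r) := by
        rw [h4]
        apply pt_ext <;> simp only [lineMap_coord] <;> field_simp <;> ring
      have hneg : pw z₀ c₀ (AffineMap.lineMap u v σ) < 0 := by
        rw [pw_lineMap, ht₀.pw_eq u (by simp), ht₀.pw_eq v (by simp)]
        have : 0 < (u 0 - v 0) ^ 2 + (u 1 - v 1) ^ 2 := by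
          by_contra! hle
          exact huv (pt_ext (by nlinarith [sq_nonneg (u 0 - v 0), sq_nonneg (u 1 - v 1)])
            (by nlinarith [sq_nonneg (u 0 - v 0), sq_nonneg (u 1 - v 1)]))
        have := sub_pos.2 h2
        simp only [mul_zero, zero_add, zero_sub, neg_neg_iff_pos]
        positivity
      have := pw_lineMap_neg_of_right (a := 1 / r) (by positivity)
        (by rw [div_le_one h3]; exact hr) hs₀.le hneg
      rw [← hb'] at this
      exact absurd (hτ b hb) (not_le.2 this)
  obtain ⟨a, b, rfl⟩ : ∃ a b, t = {s, a, b} := by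
    obtain ⟨a, b, -, hab⟩ := Finset.card_eq_two.1
      (show (t.erase s).card = 2 by rw [Finset.card_erase_of_mem hst, (hT.1.2.1 t ht).1])
    exact ⟨a, b, by rw [← hab, Finset.insert_erase hst]⟩
  obtain ⟨l, m, n, -, hm, hn, hlmn, hx⟩ := mem_triSet_iff.1 het
  have hD : orient s a b ≠ 0 := hgp.orient_ne_zero_of_card (hT.1.2.1 _ ht).1 (hT.1.2.1 _ ht).2
  obtain ⟨-, hm', hn'⟩ := orient_of_barycentric hlmn hx
  rw [isAff_orient, orient_self_right, mul_zero, zero_add] at hm'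
  rw [isAff_orient, orient_self_left, mul_zero, zero_add] at hn'
  have hcone : ∀ σ : ℝ, 0 ≤ σ → σ ≤ 1 →
      0 ≤ orient b s (AffineMap.lineMap u v σ) / orient s a b ∧
      0 ≤ orient s a (AffineMap.lineMap u v σ) / orient s a b := by
    intro σ h0 h1
    by_contra hcon
    rw [not_and_or, not_le, not_le] at hcon
    obtain ⟨d, hd0, hd1, hA, hB, hAB⟩ := exists_quadrant_boundary
      (f := orient b s (AffineMap.lineMap u v (1 / 2 : ℝ)) / orient s a b)
      (g := orient s a (AffineMap.lineMap u v (1 / 2 : ℝ)) / orient s a b)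
      (by rw [show orient b s (AffineMap.lineMap u v (1 / 2 : ℝ)) / orient s a b = m / e by
            rw [div_eq_div_iff hD he.ne']; linarith]
          positivity)
      (by rw [show orient s a (AffineMap.lineMap u v (1 / 2 : ℝ)) / orient s a b = n / e by
            rw [div_eq_div_iff hD he.ne']; linarith]
          positivity) hcon
    rw [mul_div, mul_div, ← add_div, ← isAff_orient] at hA hB hAB
    rw [mul_div, mul_div, ← add_div, ← isAff_orient] at hAB
    have hy : AffineMap.lineMap (AffineMap.lineMap u v (1 / 2 : ℝ) : Pt)
        (AffineMap.lineMap u v σ : Pt) d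
        = AffineMap.lineMap u v ((1 - d) * (1 / 2) + d * σ) := by
      apply pt_ext <;> simp only [lineMap_coord] <;> ring
    have hy0 : 0 < (1 - d) * (1 / 2) + d * σ := by nlinarith
    have hy1 : (1 - d) * (1 / 2) + d * σ < 1 := by nlinarith
    rw [hy] at hA hB hAB
    obtain ⟨hsum, hbar⟩ := orient_barycentric hD (AffineMap.lineMap u v ((1 - d) * (1 / 2) + d * σ))
    rcases hAB with h | h
    · refine hedge b (by simp) _ _ hy0 hy1 hB ?_
      rw [h, add_zero] at hsum
      have : ∀ i, _ := fun i => (hbar i).trans (by rw [h, eq_sub_of_add_eq hsum])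
      apply pt_ext <;> rw [this] <;> simp only [lineMap_coord] <;> ring
    · refine hedge a (by simp) _ _ hy0 hy1 hA ?_
      rw [h, add_zero] at hsum
      have : ∀ i, _ := fun i => (hbar i).trans (by rw [h, eq_sub_of_add_eq hsum])
      apply pt_ext <;> rw [this] <;> simp only [lineMap_coord] <;> ring
  obtain ⟨z, c, hz, hk⟩ := (hT.2 _ ht).exists_pw ⟨s, by simp⟩
  refine (encard_le_encard ?_).trans hk
  rintro p ⟨hp, hpz⟩
  refine ⟨hp, ?_⟩
  obtain ⟨σ, r, h1, h2, h3, h4, h5⟩ := ht₀.exists_lineMap_eq huv hs hp hpz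
  obtain ⟨hA, hB⟩ := hcone σ h1.le h2.le
  obtain ⟨hsum, hbar⟩ := orient_barycentric hD (AffineMap.lineMap u v σ)
  have hL := isAff_pw_sub z₀ z c₀ c
  have hy : 0 ≤ pw z₀ c₀ (AffineMap.lineMap u v σ) - pw z c (AffineMap.lineMap u v σ) := by
    rw [hL.barycentric hsum hbar]
    have hs0 : pw z₀ c₀ s - pw z c s = 0 := by rw [hs₀, hz s (by simp), sub_zero]
    have ha0 : 0 ≤ pw z₀ c₀ a - pw z c a := by rw [hz a (by simp), sub_zero]; exact hτ a (by simp)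
    have hb0 : 0 ≤ pw z₀ c₀ b - pw z c b := by rw [hz b (by simp), sub_zero]; exact hτ b (by simp)
    rw [hs0, mul_zero, zero_add]
    exact add_nonneg (mul_nonneg hA ha0) (mul_nonneg hB hb0)
  have hLp := hL s p r
  simp only [hs₀, hz s (by simp), sub_zero, mul_zero, zero_add, ← h5] at hLp
  rw [hLp] at hy
  have := nonneg_of_mul_nonneg_right hy h3
  linarith

/-! ### The triangulation of the hull -/

/-- The Delaunay triangles of the points to the left of `uv` contained in the hull of `uv`. -/
def leftTriangles (P : Set Pt) (T : Set (Finset Pt)) (u v : Pt) : Set (Finset Pt) :=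
  {t | triSet t ⊆ hull T u v ∧ ∃ z c, IsDelaunayTri (leftPts P u v) t z c}

/-- The Delaunay triangles on either side of `uv` contained in the hull of `uv`. -/
def hullTriangles (P : Set Pt) (T : Set (Finset Pt)) (u v : Pt) : Set (Finset Pt) :=
  leftTriangles P T u v ∪ leftTriangles P T v u

lemma IsDelaunayTri.mem_of_mem_triSet {Q : Set Pt} (hgp : GenPos Q) {t : Finset Pt} {z : Pt}
    {c : ℝ} (ht : IsDelaunayTri Q t z c) {p : Pt} (hp : p ∈ Q) (hpt : p ∈ triSet t) : p ∈ t := by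
  by_contra hcon
  have hint : p ∈ interior (triSet t) := by
    refine mem_interior_of_orient_ne_zero ht.card hpt fun a ha b hb hab => ?_
    refine hgp.orient_ne_zero (ht.subset ha) (ht.subset hb) hp hab ?_ ?_ <;> rintro rfl
    exacts [hcon ha, hcon hb]
  exact absurd (ht.empty p hp) (not_le.2 (interior_triSet_pw_neg ht.pw_eq hint))

section Hull

variable {P : Set Pt} {T : Set (Finset Pt)} {u v : Pt}

lemma exists_edge_mem_leftTriangles (hfin : P.Finite) (hgp : GenPos P) (huv : u ≠ v) (hu : u ∈ P)
    (hv : v ∈ P) (hT : IsOrderDT P 0 T) (hno : ∀ t ∈ T, u ∈ t → v ∉ t) {q : Pt} (hq : q ∈ P)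
    (hql : 0 < orient u v q) : ∃ s, {u, v, s} ∈ leftTriangles P T u v := by
  obtain ⟨s, z, c, hs, ht⟩ := exists_isDelaunayTri_edge hfin hgp huv hu hv hq hql
  refine ⟨s, ?_, z, c, ht⟩
  have htP := ht.subset.trans (leftPts_subset P u v)
  by_cases hp : ∃ p ∈ P, pw z c p < 0
  · obtain ⟨p, hp, hpz⟩ := hp
    obtain ⟨σ, r, h1, h2, h3, h4, h5⟩ := ht.exists_lineMap_eq huv hs hp hpz
    have hy : pw z c (AffineMap.lineMap u v σ) < 0 := by
      rw [h5]
      exact pw_lineMap_neg_of_right h3 h4.le (ht.pw_eq s (by simp)).le hpz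
    refine ht.subset_hull_of_chord hfin hgp huv hT hp hpz fun y' => ?_
    refine mem_segment_of_pw_neg huv (ht.pw_eq u (by simp)).ge (ht.pw_eq v (by simp)).ge ?_ hy
    rw [segment_eq_image_lineMap]
    exact ⟨σ, ⟨h1.le, h2.le⟩, rfl⟩
  · push Not at hp
    have htP' : IsDelaunayTri P {u, v, s} z c := ⟨ht.card, htP, ht.pw_eq, hp⟩
    obtain ⟨x, hx, hgen⟩ := exists_isGeneric_mem hfin isOpen_interior
      (hgp.interior_nonempty ht.card htP)
    obtain ⟨e, heT, hxe⟩ := hT.1.exists_mem_interior hgen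
      (convexHull_mono htP (interior_subset hx))
    obtain ⟨z', c', he⟩ := hT.exists_isDelaunayTri heT
    obtain rfl := htP'.eq_of_interior hgp he hx hxe
    exact absurd (show v ∈ _ by simp) (hno _ heT (by simp))

lemma exists_edge_mem_hullTriangles (hfin : P.Finite) (hgp : GenPos P) (huv : u ≠ v) (hu : u ∈ P)
    (hv : v ∈ P) (hT : IsOrderDT P 0 T) (hno : ∀ t ∈ T, u ∈ t → v ∉ t) :
    ∃ t ∈ hullTriangles P T u v, u ∈ t ∧ v ∈ t := by
  obtain ⟨t, ht, hut⟩ := hT.1.2.2.1 u hu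
  have hvt := hno t ht hut
  obtain ⟨q, hqt, hqu⟩ := Finset.exists_mem_ne (s := t) (by rw [(hT.1.2.1 t ht).1]; norm_num) u
  have hq := (hT.1.2.1 t ht).2 hqt
  rcases (hgp.orient_ne_zero hu hv hq huv hqu.symm (by rintro rfl; exact hvt hqt)).lt_or_gt
    with h | h
  · obtain ⟨s, hs⟩ := exists_edge_mem_leftTriangles hfin hgp huv.symm hv hu hT
      (fun t ht hv hu => hno t ht hu hv) hq (by rw [orient_swap]; linarith)
    exact ⟨_, Or.inr hs, by simp, by simp⟩
  · obtain ⟨s, hs⟩ := exists_edge_mem_leftTriangles hfin hgp huv hu hv hT hno hq h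
    exact ⟨_, Or.inl hs, by simp, by simp⟩

lemma exists_crossed_mem_interior (hT : IsTriangulation P T) {x : Pt} (hgen : IsGeneric P x)
    (hx : x ∈ hull T u v) : ∃ d ∈ crossed T u v, x ∈ interior (triSet d) := by
  simp only [hull, mem_iUnion] at hx
  obtain ⟨d, hd, hxd⟩ := hx
  exact ⟨d, hd, hgen.mem_interior (hT.2.1 d hd.1).1 (hT.2.1 d hd.1).2 hxd⟩

lemma orderKTri_of_mem_leftTriangles (hfin : P.Finite) (hgp : GenPos P) (huv : u ≠ v)
    (hu : u ∈ P) (hv : v ∈ P) (hT : IsOrderDT P 0 T) {k : ℕ} {T' : Set (Finset Pt)}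
    (hT' : IsOrderDT P k T') {t' : Finset Pt} (ht' : t' ∈ T') (hut' : u ∈ t') (hvt' : v ∈ t')
    {t : Finset Pt} (ht : t ∈ leftTriangles P T u v) : OrderKTri P k t := by
  obtain ⟨hsub, z, c, ht⟩ := ht
  have htP := ht.subset.trans (leftPts_subset P u v)
  have hne : t.Nonempty := Finset.card_pos.1 (by rw [ht.card]; norm_num)
  obtain ⟨x, hx, hgen⟩ := exists_isGeneric_mem hfin isOpen_interior
    (hgp.interior_nonempty ht.card htP)
  obtain ⟨d, hd, hxd⟩ := exists_crossed_mem_interior hT.1 hgen (hsub (interior_subset hx))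
  refine orderKTri_of_pw hne ht.pw_eq ?_
  rcases (ht.subset_hull_of_interior hfin hgp huv hu hv hT hd hx hxd).2 with h | h
  · have h0 : {p ∈ P | pw z c p < 0} = ∅ :=
      eq_empty_of_forall_notMem fun p hp => absurd (h.empty p hp.1) (not_le.2 hp.2)
    simp [h0]
  · obtain ⟨a, ha, hal⟩ := ht.exists_orient_pos hgp huv hu hv
    obtain ⟨s, z₀, c₀, hs, ht₀⟩ := exists_isDelaunayTri_edge hfin hgp huv hu hv (htP ha) hal
    refine le_trans (encard_le_encard ?_) (ht₀.encard_le hgp huv hs hT' ht' hut' hvt')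
    exact fun p hp => ⟨hp.1, ht.pw_neg_of_chord hgp huv hu hv ht₀ (by simp) (by simp) h hp.1 hp.2⟩

lemma orderKTri_of_mem_hullTriangles (hfin : P.Finite) (hgp : GenPos P) (huv : u ≠ v)
    (hu : u ∈ P) (hv : v ∈ P) (hT : IsOrderDT P 0 T) {k : ℕ} (hk : UsefulEdge P k u v)
    {t : Finset Pt} (ht : t ∈ hullTriangles P T u v) : OrderKTri P k t := by
  obtain ⟨T', hT', t', ht', hut', hvt'⟩ := hk
  rcases ht with ht | ht
  · exact orderKTri_of_mem_leftTriangles hfin hgp huv hu hv hT hT' ht' hut' hvt' ht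
  · exact orderKTri_of_mem_leftTriangles hfin hgp huv.symm hv hu hT hT' ht' hvt' hut' ht

lemma card_subset_of_mem_hullTriangles {t : Finset Pt} (ht : t ∈ hullTriangles P T u v) :
    t.card = 3 ∧ (t : Set Pt) ⊆ P ∧ triSet t ⊆ hull T u v := by
  rcases ht with ⟨hsub, z, c, ht⟩ | ⟨hsub, z, c, ht⟩
  · exact ⟨ht.card, ht.subset.trans (leftPts_subset P u v), hsub⟩
  · exact ⟨ht.card, ht.subset.trans (leftPts_subset P v u), hull_comm T v u ▸ hsub⟩

lemma finite_hullTriangles (hfin : P.Finite) : (hullTriangles P T u v).Finite := by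
  refine (hfin.toFinset.powerset.finite_toSet).subset fun t ht => ?_
  simp only [Finset.coe_powerset, mem_preimage, mem_powerset_iff, Finite.coe_toFinset]
  exact (card_subset_of_mem_hullTriangles ht).2.1

lemma pairwise_hullTriangles (hgp : GenPos P) (huv : u ≠ v) :
    (hullTriangles P T u v).Pairwise
      fun s t => interior (triSet s) ∩ interior (triSet t) = ∅ := by
  intro s hs t ht hne
  refine eq_empty_of_forall_notMem fun x ⟨hxs, hxt⟩ => ?_
  rcases hs with ⟨-, z, c, hs⟩ | ⟨-, z, c, hs⟩ <;> rcases ht with ⟨-, z', c', ht⟩ | ⟨-, z', c', ht⟩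
  · exact hne (hs.eq_of_interior (hgp.mono (leftPts_subset P u v)) ht hxs hxt)
  · have h1 := hs.orient_pos huv hxs
    have h2 := ht.orient_pos huv.symm hxt
    rw [orient_swap] at h2
    linarith
  · have h1 := hs.orient_pos huv.symm hxs
    have h2 := ht.orient_pos huv hxt
    rw [orient_swap] at h1
    linarith
  · exact hne (hs.eq_of_interior (hgp.mono (leftPts_subset P v u)) ht hxs hxt)

lemma iUnion_hullTriangles (hfin : P.Finite) (hgp : GenPos P) (huv : u ≠ v) (hu : u ∈ P)
    (hv : v ∈ P) (hT : IsOrderDT P 0 T) :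
    ⋃ t ∈ hullTriangles P T u v, triSet t = hull T u v := by
  refine (iUnion₂_subset fun t ht => (card_subset_of_mem_hullTriangles ht).2.2).antisymm
    (iUnion₂_subset fun d hd => ?_)
  refine hgp.triSet_subset_of_isGeneric hfin (hT.1.2.1 d hd.1).1 (hT.1.2.1 d hd.1).2
    ((finite_hullTriangles hfin).isClosed_biUnion fun t _ => isClosed_triSet t) fun x hx hgen => ?_
  rcases (hgen u hu v hv huv).lt_or_gt with h | h
  · obtain ⟨t, z, c, ht, hsub, hxt⟩ := exists_isDelaunayTri_of_mem_hull hfin hgp huv.symm hv hu hT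
      (crossed_comm T u v ▸ hd) hgen hx (by rw [orient_swap]; linarith)
    exact mem_biUnion (Or.inr ⟨hsub, z, c, ht⟩ : t ∈ hullTriangles P T u v) hxt
  · obtain ⟨t, z, c, ht, hsub, hxt⟩ :=
      exists_isDelaunayTri_of_mem_hull hfin hgp huv hu hv hT hd hgen hx h
    exact mem_biUnion (Or.inl ⟨hsub, z, c, ht⟩ : t ∈ hullTriangles P T u v) hxt

lemma mem_of_mem_triSet_of_mem_hullTriangles (hgp : GenPos P) {t : Finset Pt}
    (ht : t ∈ hullTriangles P T u v) {p : Pt} (hp : p ∈ P) (hpt : p ∈ triSet t) : p ∈ t := by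
  rcases ht with ⟨-, z, c, ht⟩ | ⟨-, z, c, ht⟩ <;>
  exact ht.mem_of_mem_triSet (hgp.mono (leftPts_subset P _ _))
    ⟨hp, (isAff_orient _ _).nonneg_of_mem_triSet (fun q hq => (ht.subset hq).2) hpt⟩ hpt

/-- Retriangulating the hull of `uv` in a Delaunay triangulation gives a triangulation. -/
lemma IsOrderDT.isTriangulation_retriangulate (hfin : P.Finite) (hgp : GenPos P) (huv : u ≠ v)
    (hu : u ∈ P) (hv : v ∈ P) (hT : IsOrderDT P 0 T) :
    IsTriangulation P (T \ crossed T u v ∪ hullTriangles P T u v) := by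
  have hS := iUnion_hullTriangles hfin hgp huv hu hv hT
  have hcross : ∀ e ∈ T \ crossed T u v, ∀ t ∈ hullTriangles P T u v,
      interior (triSet e) ∩ interior (triSet t) = ∅ := by
    intro e he t ht
    by_contra hne
    obtain ⟨x, ⟨hxe, hxt⟩, hgen⟩ := exists_isGeneric_mem hfin
      (isOpen_interior.inter isOpen_interior) (nonempty_iff_ne_empty.2 hne)
    obtain ⟨d, hd, hxd⟩ := exists_crossed_mem_interior hT.1 hgen
      ((card_subset_of_mem_hullTriangles ht).2.2 (interior_subset hxt))
    obtain rfl := hT.1.eq_of_interior he.1 hd.1 hxe hxd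
    exact he.2 hd
  refine ⟨(hT.1.1.subset sdiff_subset).union (finite_hullTriangles hfin), ?_, ?_, ?_, ?_⟩
  · rintro t (ht | ht)
    · exact hT.1.2.1 t ht.1
    · exact ⟨(card_subset_of_mem_hullTriangles ht).1, (card_subset_of_mem_hullTriangles ht).2.1⟩
  · intro p hp
    obtain ⟨d, hd, hpd⟩ := hT.1.2.2.1 p hp
    by_cases hdc : d ∈ crossed T u v
    · have hph : p ∈ hull T u v := mem_biUnion hdc (subset_convexHull ℝ _ hpd)
      rw [← hS] at hph
      simp only [mem_iUnion] at hph
      obtain ⟨t, ht, hpt⟩ := hph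
      exact ⟨t, Or.inr ht, mem_of_mem_triSet_of_mem_hullTriangles hgp ht hp hpt⟩
    · exact ⟨d, Or.inl ⟨hd, hdc⟩, hpd⟩
  · rintro s (hs | hs) t (ht | ht) hne
    · exact hT.1.2.2.2.1 hs.1 ht.1 hne
    · exact hcross s hs t ht
    · rw [inter_comm]; exact hcross t ht s hs
    · exact pairwise_hullTriangles hgp huv hs ht hne
  · rw [biUnion_union, hS, hull, ← biUnion_union, sdiff_union_of_subset (show crossed T u v ⊆ T from sep_subset _ _)]
    exact hT.1.2.2.2.2

end Hull

/-- Lemma 2.11: let `{u,v}` be a useful order-`k` edge (not useful order-`i` for any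
`i < k`), `k ≥ 1`, and let `H` be its hull, the closure of the union of the Delaunay
triangles whose interior intersects segment `uv`. Then `H` admits a triangulation
(a finite set of triangles with vertices among the points of `P` in `H`, pairwise
disjoint interiors, union `H`) containing `uv` as a side of a triangle, all of whose
triangles are order-`k` Delaunay and at least one of which is not order-`(k-1)`
Delaunay. -/
theorem hull_has_order_k_triangulation_containing_edge
    (P : Set Pt) (hfin : P.Finite) (hgp : GenPos P) (k : ℕ) (hk : 1 ≤ k)
    (u v : Pt) (hu : u ∈ P) (hv : v ∈ P) (huv : u ≠ v)
    (huseful : UsefulEdge P k u v) (hnot : ∀ i < k, ¬ UsefulEdge P i u v)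
    (T : Set (Finset Pt)) (hT : IsOrderDT P 0 T)
    (H : Set Pt)
    (hH : H = closure (⋃ t ∈ {t ∈ T | (interior (triSet t) ∩ segment ℝ u v).Nonempty},
      triSet t)) :
    ∃ S : Set (Finset Pt), S.Finite ∧
      (∀ s ∈ S, s.card = 3 ∧ (s : Set Pt) ⊆ P ∩ H) ∧
      (S.Pairwise fun s s' => interior (triSet s) ∩ interior (triSet s') = ∅) ∧
      (⋃ s ∈ S, triSet s) = H ∧
      (∃ s ∈ S, u ∈ s ∧ v ∈ s) ∧
      (∀ s ∈ S, OrderKTri P k s) ∧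
      (∃ s ∈ S, ¬ OrderKTri P (k - 1) s) := by
  have hHull : H = hull T u v := by
    rw [hH]
    exact (isClosed_hull hT.1.1 u v).closure_eq
  rw [hHull]
  have hno : ∀ t ∈ T, u ∈ t → v ∉ t := fun t ht hut hvt => hnot 0 hk ⟨T, hT, t, ht, hut, hvt⟩
  have hedge := exists_edge_mem_hullTriangles hfin hgp huv hu hv hT hno
  refine ⟨hullTriangles P T u v, finite_hullTriangles hfin, fun s hs => ?_,
    pairwise_hullTriangles hgp huv, iUnion_hullTriangles hfin hgp huv hu hv hT, hedge,
    fun s hs => orderKTri_of_mem_hullTriangles hfin hgp huv hu hv hT huseful hs, ?_⟩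
  · obtain ⟨hcard, hsP, hsub⟩ := card_subset_of_mem_hullTriangles hs
    exact ⟨hcard, subset_inter hsP ((subset_convexHull ℝ _).trans hsub)⟩
  · by_contra! hall
    obtain ⟨t, ht, hut, hvt⟩ := hedge
    refine hnot (k - 1) (by omega) ⟨T \ crossed T u v ∪ hullTriangles P T u v,
      ⟨hT.isTriangulation_retriangulate hfin hgp huv hu hv, ?_⟩, t, Or.inr ht, hut, hvt⟩
    rintro s (hs | hs)
    · obtain ⟨z, r, h1, h2⟩ := hT.2 s hs.1
      exact ⟨z, r, h1, h2.trans (by simp)⟩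
    · exact hall s hs

end
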